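/- arXiv:2112.13190 — 3 statements merged into one kernel-verified Lean document; each statement's English description precedes it below -/
import Mathlib

section
/- For every b > 0 and ε > 0 there exists a constant c = c(b, ε) > 0 such that the following holds: for every probability p with 0 < p ≤ 1 and every b-bounded weight function w on a finite vertex set V with vol_w(V)·p ≥ c·|V|, with probability at least 1 − ε the random weight function w_p satisfies both (a) |q*(w_p) − q*(w)| < ε, and (b) for every partition 𝒜 of V there exists a partition 𝒜′ of V, each of whose parts is a union of parts of 𝒜, such that δ_{𝒜′}(w) < δ_𝒜(w_p) + ε. -/
open Finset
open scoped Classical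

/-- The weighted degree deg_w(u) = Σ_v w(u,v). -/
noncomputable def wDeg {V : Type} [Fintype V] (w : V → V → ℝ) (u : V) : ℝ :=
  ∑ v, w u v

/-- The weighted volume vol_w(X) = Σ_{u∈X} deg_w(u). -/
noncomputable def wVol {V : Type} [Fintype V] (w : V → V → ℝ) (X : Finset V) : ℝ :=
  ∑ u ∈ X, wDeg w u

/-- The weighted edge count e_w(A) = (1/2)·Σ_{u,v∈A} w(u,v). -/
noncomputable def wEdge {V : Type} [Fintype V] (w : V → V → ℝ) (A : Finset V) : ℝ :=
  (1 / 2) * ∑ u ∈ A, ∑ v ∈ A, w u v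

/-- The weighted modularity score q_𝒜(w) of a partition 𝒜 of V; it is 0 if
vol_w(V) = 0 (for nonnegative w this means w is identically zero). -/
noncomputable def wModScore {V : Type} [Fintype V] [DecidableEq V] (w : V → V → ℝ)
    (P : Finpartition (univ : Finset V)) : ℝ :=
  if wVol w univ = 0 then 0 else
    (∑ A ∈ P.parts, 2 * wEdge w A) / wVol w univ
      - (∑ A ∈ P.parts, (wVol w A) ^ 2) / (wVol w univ) ^ 2

/-- The weighted modularity q*(w) = max_𝒜 q_𝒜(w). -/
noncomputable def wModularity {V : Type} [Fintype V] [DecidableEq V] (w : V → V → ℝ) : ℝ :=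
  ⨆ P : Finpartition (univ : Finset V), wModScore w P

/-- The probability that the random weight function w_p (each unordered pair of
vertices independently keeps its w-value with probability p and is set to 0
otherwise) satisfies the predicate Q. -/
noncomputable def wProb {V : Type} [Fintype V] [DecidableEq V] (w : V → V → ℝ) (p : ℝ)
    (Q : (V → V → ℝ) → Prop) : ℝ :=
  ∑ S ∈ (univ : Finset (Sym2 V)).powerset,
    if Q (fun u v => if s(u, v) ∈ S then w u v else 0) then
      p ^ S.card * (1 - p) ^ (Fintype.card (Sym2 V) - S.card)
    else 0

section Modularity

variable {V : Type} [Fintype V] {w : V → V → ℝ}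

lemma wVol_nonneg (h0 : ∀ u v, 0 ≤ w u v) (A : Finset V) : 0 ≤ wVol w A :=
  sum_nonneg fun u _ => sum_nonneg fun v _ => h0 u v

lemma two_mul_wEdge (A : Finset V) : 2 * wEdge w A = ∑ u ∈ A, ∑ v ∈ A, w u v := by
  rw [wEdge]; ring

lemma two_mul_wEdge_nonneg (h0 : ∀ u v, 0 ≤ w u v) (A : Finset V) : 0 ≤ 2 * wEdge w A := by
  rw [two_mul_wEdge]
  exact sum_nonneg fun u _ => sum_nonneg fun v _ => h0 u v

lemma two_mul_wEdge_univ : 2 * wEdge w univ = wVol w univ := two_mul_wEdge _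

lemma two_mul_wEdge_le_wVol (h0 : ∀ u v, 0 ≤ w u v) (A : Finset V) :
    2 * wEdge w A ≤ wVol w univ := by
  rw [two_mul_wEdge]
  calc ∑ u ∈ A, ∑ v ∈ A, w u v ≤ ∑ u ∈ A, ∑ v, w u v :=
        sum_le_sum fun u _ => sum_le_sum_of_subset_of_nonneg (subset_univ _) fun v _ _ => h0 u v
    _ ≤ _ := sum_le_sum_of_subset_of_nonneg (subset_univ _)
        fun u _ _ => sum_nonneg fun v _ => h0 u v

lemma wVol_le_wVol_univ (h0 : ∀ u v, 0 ≤ w u v) (A : Finset V) : wVol w A ≤ wVol w univ :=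
  sum_le_sum_of_subset_of_nonneg (subset_univ _) fun u _ _ => sum_nonneg fun v _ => h0 u v

/-- If the edge weights inside all sets are close then so are the normalised edge weights. -/
lemma abs_div_wVol_sub_le {w' : V → V → ℝ} (h0' : ∀ u v, 0 ≤ w' u v)
    (hv : 0 < wVol w univ) (hv' : 0 < wVol w' univ) {p η : ℝ} (hp : 0 < p)
    (h : ∀ A : Finset V, |2 * wEdge w' A - p * (2 * wEdge w A)| ≤ η * (p * wVol w univ))
    (A : Finset V) :
    |2 * wEdge w' A / wVol w' univ - 2 * wEdge w A / wVol w univ| ≤ 2 * η := by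
  have hA := h A
  have hV := h univ
  rw [two_mul_wEdge_univ, two_mul_wEdge_univ] at hV
  have hx0 := two_mul_wEdge_nonneg h0' A
  have hx1 := two_mul_wEdge_le_wVol h0' A
  set x := 2 * wEdge w A
  set x' := 2 * wEdge w' A
  set a := wVol w univ
  set a' := wVol w' univ
  have hD : 0 < p * a := mul_pos hp hv
  have hr : x' / a' ≤ 1 := (div_le_one hv').2 hx1
  have hr0 : 0 ≤ x' / a' := by positivity
  have key : x' / a' - x / a = ((x' - p * x) + x' / a' * (p * a - a')) / (p * a) := by
    field_simp; ring
  rw [key, abs_div, abs_of_pos hD, div_le_iff₀ hD]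
  have h2 : |x' / a' * (p * a - a')| ≤ η * (p * a) := by
    rw [abs_mul, abs_of_nonneg hr0, abs_sub_comm]
    exact (mul_le_of_le_one_left (abs_nonneg _) hr).trans hV
  calc _ ≤ |x' - p * x| + |x' / a' * (p * a - a')| := abs_add_le _ _
    _ ≤ _ := by linarith

variable [DecidableEq V]

/-- Merging two parts of a partition. -/
lemma Finpartition.exists_merge_parts (P : Finpartition (univ : Finset V)) {A B : Finset V}
    (hA : A ∈ P.parts) (hB : B ∈ P.parts) (hAB : A ≠ B) :
    ∃ P' : Finpartition (univ : Finset V), P ≤ P' ∧ P'.parts.card + 1 = P.parts.card ∧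
      ∀ f : Finset V → ℝ,
        ∑ C ∈ P'.parts, f C = ∑ C ∈ P.parts, f C - f A - f B + f (A ∪ B) := by
  have hB' : B ∈ P.parts.erase A := mem_erase.2 ⟨hAB.symm, hB⟩
  have hdis : ∀ C ∈ (P.parts.erase A).erase B, Disjoint (A ∪ B) C := by
    intro C hC
    simp only [mem_erase] at hC
    exact disjoint_union_left.2
      ⟨P.disjoint hA hC.2.2 hC.2.1.symm, P.disjoint hB hC.2.2 hC.1.symm⟩
  have hne : (A ∪ B).Nonempty := (P.nonempty_of_mem_parts hA).mono subset_union_left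
  have hnot : A ∪ B ∉ (P.parts.erase A).erase B := fun h =>
    hne.ne_empty (disjoint_self.1 (hdis _ h))
  let P' : Finpartition (univ : Finset V) :=
    { parts := insert (A ∪ B) ((P.parts.erase A).erase B)
      supIndep := by
        rw [supIndep_iff_pairwiseDisjoint, coe_insert]
        refine Set.PairwiseDisjoint.insert ?_ fun C hC _ => hdis C hC
        exact P.disjoint.subset fun C hC => mem_of_mem_erase (mem_of_mem_erase hC)
      sup_parts := by
        have h := P.sup_parts
        rw [← insert_erase hA, ← insert_erase hB', sup_insert, sup_insert] at h
        rw [sup_insert]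
        exact (sup_assoc _ _ _).trans h
      bot_notMem := by
        rw [mem_insert, not_or]
        exact ⟨hne.ne_empty.symm,
          fun h => P.bot_notMem (mem_of_mem_erase (mem_of_mem_erase h))⟩ }
  have hcard := card_erase_add_one hA
  have hcard' := card_erase_add_one hB'
  refine ⟨P', fun C hC => ?_, ?_, fun f => ?_⟩
  · by_cases h1 : C = A
    · exact ⟨A ∪ B, mem_insert_self _ _, h1 ▸ subset_union_left⟩
    by_cases h2 : C = B
    · exact ⟨A ∪ B, mem_insert_self _ _, h2 ▸ subset_union_right⟩
    exact ⟨C, mem_insert_of_mem (mem_erase.2 ⟨h2, mem_erase.2 ⟨h1, hC⟩⟩), le_rfl⟩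
  · change (insert (A ∪ B) ((P.parts.erase A).erase B)).card + 1 = _
    rw [card_insert_of_notMem hnot]
    omega
  · change ∑ C ∈ insert (A ∪ B) ((P.parts.erase A).erase B), f C = _
    rw [sum_insert hnot, ← add_sum_erase _ f hA, ← add_sum_erase _ f hB']
    ring

lemma two_mul_wEdge_add_le_union (h0 : ∀ u v, 0 ≤ w u v) {A B : Finset V} (h : Disjoint A B) :
    2 * wEdge w A + 2 * wEdge w B ≤ 2 * wEdge w (A ∪ B) := by
  simp only [two_mul_wEdge, sum_union h, sum_add_distrib]
  have h1 : 0 ≤ ∑ u ∈ A, ∑ v ∈ B, w u v := sum_nonneg fun u _ => sum_nonneg fun v _ => h0 u v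
  have h2 : 0 ≤ ∑ u ∈ B, ∑ v ∈ A, w u v := sum_nonneg fun u _ => sum_nonneg fun v _ => h0 u v
  linarith

/-- Volumes are determined by edge weights inside sets. -/
lemma two_mul_wVol (hs : ∀ u v, w u v = w v u) (A : Finset V) :
    2 * wVol w A = wVol w univ + 2 * wEdge w A - 2 * wEdge w Aᶜ := by
  have hd (u : V) : wDeg w u = ∑ v ∈ A, w u v + ∑ v ∈ Aᶜ, w u v :=
    (sum_add_sum_compl A _).symm
  have hc : ∑ u ∈ A, ∑ v ∈ Aᶜ, w u v = ∑ u ∈ Aᶜ, ∑ v ∈ A, w u v := by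
    rw [sum_comm]
    exact sum_congr rfl fun u _ => sum_congr rfl fun v _ => hs _ _
  have h1 : wVol w univ = wVol w A + wVol w Aᶜ := (sum_add_sum_compl A _).symm
  rw [h1]
  simp only [wVol, two_mul_wEdge, hd, sum_add_distrib]
  linarith

lemma sum_parts_wVol (P : Finpartition (univ : Finset V)) :
    ∑ A ∈ P.parts, wVol w A = wVol w univ := by
  conv_rhs => rw [wVol, ← P.biUnion_parts, sum_biUnion P.disjoint]
  rfl

/-- Some pair of parts can be merged at little loss of modularity. -/
lemma exists_merge_wModScore (h0 : ∀ u v, 0 ≤ w u v) (hv : 0 < wVol w univ)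
    (P : Finpartition (univ : Finset V)) {m : ℕ} (hm : P.parts.card = m + 1) (hm0 : 0 < m) :
    ∃ P' : Finpartition (univ : Finset V), P ≤ P' ∧ P'.parts.card = m ∧
      wModScore w P - 2 / ((m + 1) * m) ≤ wModScore w P' := by
  obtain ⟨⟨A, B⟩, hAB, hle⟩ : ∃ x ∈ P.parts.offDiag,
      wVol w x.1 * wVol w x.2 ≤ wVol w univ ^ 2 / ((m + 1) * m) := by
    have hcard : (P.parts.offDiag.card : ℝ) = (m + 1) * m := by
      rw [offDiag_card, hm, ← Nat.mul_sub_one]; push_cast; simp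
    have hm0' : (0 : ℝ) < m := by exact_mod_cast hm0
    refine exists_le_of_sum_le ?_ ?_
    · rw [← card_pos]
      have : (0 : ℝ) < P.parts.offDiag.card := by rw [hcard]; positivity
      exact_mod_cast this
    · rw [sum_const, nsmul_eq_mul, hcard, mul_div_cancel₀ _ (by positivity)]
      calc ∑ x ∈ P.parts.offDiag, wVol w x.1 * wVol w x.2
          ≤ ∑ x ∈ P.parts ×ˢ P.parts, wVol w x.1 * wVol w x.2 :=
            sum_le_sum_of_subset_of_nonneg
              (fun x hx => by rw [mem_offDiag] at hx; exact mem_product.2 ⟨hx.1, hx.2.1⟩)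
              fun x _ _ => mul_nonneg (wVol_nonneg h0 _) (wVol_nonneg h0 _)
        _ = wVol w univ ^ 2 := by
            rw [sum_product, ← sum_mul_sum, sum_parts_wVol, sq]
  rw [mem_offDiag] at hAB
  obtain ⟨hA, hB, hne⟩ := hAB
  obtain ⟨P', hP, hc, hf⟩ := P.exists_merge_parts hA hB hne
  refine ⟨P', hP, by omega, ?_⟩
  have hd : Disjoint A B := P.disjoint hA hB hne
  have hvol : wVol w (A ∪ B) = wVol w A + wVol w B := sum_union hd
  have h1 := two_mul_wEdge_add_le_union h0 hd
  rw [wModScore, wModScore, if_neg hv.ne', if_neg hv.ne', hf, hf, hvol]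
  have h2 : (∑ C ∈ P.parts, 2 * wEdge w C) / wVol w univ ≤
      (∑ C ∈ P.parts, 2 * wEdge w C - 2 * wEdge w A - 2 * wEdge w B + 2 * wEdge w (A ∪ B))
        / wVol w univ := by
    gcongr; linarith
  have h3 : (∑ C ∈ P.parts, wVol w C ^ 2 - wVol w A ^ 2 - wVol w B ^ 2
      + (wVol w A + wVol w B) ^ 2) / wVol w univ ^ 2 =
      (∑ C ∈ P.parts, wVol w C ^ 2) / wVol w univ ^ 2
        + 2 * (wVol w A * wVol w B / wVol w univ ^ 2) := by
    field_simp; ring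
  have h4 : wVol w A * wVol w B / wVol w univ ^ 2 ≤ 1 / ((m + 1) * m) := by
    rw [div_le_iff₀ (by positivity)]
    exact hle.trans_eq (by ring)
  rw [h3]
  have h5 : (2 : ℝ) / ((m + 1) * m) = 2 * (1 / ((m + 1) * m)) := by ring
  linarith

/-- Every partition has a coarsening with at most `k` parts whose modularity score is smaller
by at most `2 / k`. -/
lemma exists_coarsening (h0 : ∀ u v, 0 ≤ w u v) (hv : 0 < wVol w univ) {k : ℕ} (hk : 0 < k)
    (P : Finpartition (univ : Finset V)) :
    ∃ P' : Finpartition (univ : Finset V), P ≤ P' ∧ P'.parts.card ≤ k ∧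
      wModScore w P - 2 / k ≤ wModScore w P' := by
  have hk' : (0 : ℝ) < k := by exact_mod_cast hk
  suffices H : ∀ m, k ≤ m → ∀ P : Finpartition (univ : Finset V), P.parts.card = m →
      ∃ P' : Finpartition (univ : Finset V), P ≤ P' ∧ P'.parts.card ≤ k ∧
        wModScore w P - (2 / k - 2 / m) ≤ wModScore w P' by
    rcases le_total P.parts.card k with h | h
    · exact ⟨P, le_rfl, h, by linarith [div_pos two_pos hk']⟩
    · obtain ⟨P', h1, h2, h3⟩ := H _ h P rfl
      refine ⟨P', h1, h2, ?_⟩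
      have : (0 : ℝ) ≤ 2 / (P.parts.card : ℝ) := by positivity
      linarith
  intro m hm
  induction m, hm using Nat.le_induction with
  | base => exact fun P hP => ⟨P, le_rfl, hP.le, by simp⟩
  | succ m hm ih =>
    intro P hP
    obtain ⟨Q, hPQ, hQ, hQs⟩ := exists_merge_wModScore h0 hv P hP (by omega)
    obtain ⟨P', h1, h2, h3⟩ := ih Q hQ
    refine ⟨P', hPQ.trans h1, h2, ?_⟩
    have hm' : (0 : ℝ) < m := by exact_mod_cast (by omega : 0 < m)
    have : (2 : ℝ) / ((m + 1) * m) = 2 / m - 2 / (m + 1) := by field_simp; ring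
    push_cast
    linarith

lemma le_wModularity (P : Finpartition (univ : Finset V)) : wModScore w P ≤ wModularity w :=
  le_ciSup (f := fun P => wModScore w P) (Set.finite_range _).bddAbove P

lemma abs_wModScore_sub_le {w' : V → V → ℝ} (hs : ∀ u v, w u v = w v u)
    (hs' : ∀ u v, w' u v = w' v u) (h0 : ∀ u v, 0 ≤ w u v) (h0' : ∀ u v, 0 ≤ w' u v)
    (hv : 0 < wVol w univ) (hv' : 0 < wVol w' univ) {p η : ℝ} (hp : 0 < p)
    (h : ∀ A : Finset V, |2 * wEdge w' A - p * (2 * wEdge w A)| ≤ η * (p * wVol w univ))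
    (P : Finpartition (univ : Finset V)) :
    |wModScore w' P - wModScore w P| ≤ P.parts.card * (6 * η) := by
  have hx := abs_div_wVol_sub_le h0' hv hv' hp h
  have hpart (A : Finset V) :
      |(2 * wEdge w' A / wVol w' univ - (wVol w' A / wVol w' univ) ^ 2)
        - (2 * wEdge w A / wVol w univ - (wVol w A / wVol w univ) ^ 2)| ≤ 6 * η := by
    have hy (u : V → V → ℝ) (hu : ∀ x y, u x y = u y x) (huv : 0 < wVol u univ) :
        wVol u A / wVol u univ =
          (1 + 2 * wEdge u A / wVol u univ - 2 * wEdge u Aᶜ / wVol u univ) / 2 := by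
      have := two_mul_wVol hu A
      field_simp
      linarith
    have hA := hx A
    have hC := hx Aᶜ
    have e := hy w hs hv
    have e' := hy w' hs' hv'
    have b0 : 0 ≤ wVol w A / wVol w univ := div_nonneg (wVol_nonneg h0 _) hv.le
    have b1 : wVol w A / wVol w univ ≤ 1 := (div_le_one hv).2 (wVol_le_wVol_univ h0 _)
    have b0' : 0 ≤ wVol w' A / wVol w' univ := div_nonneg (wVol_nonneg h0' _) hv'.le
    have b1' : wVol w' A / wVol w' univ ≤ 1 := (div_le_one hv').2 (wVol_le_wVol_univ h0' _)
    set y := wVol w A / wVol w univ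
    set y' := wVol w' A / wVol w' univ
    have hyy : |y' - y| ≤ 2 * η := by
      rw [abs_le] at hA hC ⊢
      constructor <;> linarith [hA.1, hA.2, hC.1, hC.2]
    have hsq : |y' ^ 2 - y ^ 2| ≤ 4 * η := by
      rw [sq_sub_sq, abs_mul, abs_of_nonneg (add_nonneg b0' b0)]
      calc (y' + y) * |y' - y| ≤ 2 * |y' - y| := by gcongr; linarith
        _ ≤ _ := by linarith
    rw [abs_le] at hA hsq ⊢
    constructor <;> linarith [hA.1, hA.2, hsq.1, hsq.2]
  have hq (u : V → V → ℝ) (huv : 0 < wVol u univ) : wModScore u P =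
      ∑ A ∈ P.parts, (2 * wEdge u A / wVol u univ - (wVol u A / wVol u univ) ^ 2) := by
    rw [wModScore, if_neg huv.ne', sum_sub_distrib, sum_div, sum_div]
    simp only [div_pow]
  rw [hq w hv, hq w' hv', ← sum_sub_distrib, ← nsmul_eq_mul]
  exact (abs_sum_le_sum_abs _ _).trans (sum_le_card_nsmul _ _ _ fun A _ => hpart A)

/-- If scores of partitions into at most `k` parts are close then modularities are close and
deficits can be transferred by coarsening. -/
lemma wModularity_close {w' : V → V → ℝ} (h0 : ∀ u v, 0 ≤ w u v)
    (h0' : ∀ u v, 0 ≤ w' u v) (hv : 0 < wVol w univ) (hv' : 0 < wVol w' univ)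
    {k : ℕ} (hk : 0 < k) {τ : ℝ} (hkτ : 2 / (k : ℝ) ≤ τ)
    (h : ∀ P : Finpartition (univ : Finset V), P.parts.card ≤ k →
      |wModScore w' P - wModScore w P| ≤ τ) :
    |wModularity w' - wModularity w| ≤ 2 * τ ∧
      ∀ A : Finpartition (univ : Finset V), ∃ A' : Finpartition (univ : Finset V), A ≤ A' ∧
        wModularity w - wModScore w A' ≤ wModularity w' - wModScore w' A + 4 * τ := by
  have h1 : ∀ A : Finpartition (univ : Finset V), ∃ A' : Finpartition (univ : Finset V),
      A ≤ A' ∧ wModScore w' A ≤ wModScore w A' + 2 * τ := fun A => by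
    obtain ⟨A', hA, hc, hs⟩ := exists_coarsening h0' hv' hk A
    exact ⟨A', hA, by linarith [(abs_le.1 (h A' hc)).2]⟩
  have h2 : wModularity w' ≤ wModularity w + 2 * τ := by
    refine ciSup_le fun A => ?_
    obtain ⟨A', -, hs⟩ := h1 A
    linarith [le_wModularity (w := w) A']
  have h3 : wModularity w ≤ wModularity w' + 2 * τ := by
    refine ciSup_le fun A => ?_
    obtain ⟨A', -, hc, hs⟩ := exists_coarsening h0 hv hk A
    linarith [le_wModularity (w := w') A', (abs_le.1 (h A' hc)).1]
  refine ⟨abs_le.2 ⟨by linarith, by linarith⟩, fun A => ?_⟩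
  obtain ⟨A', hA, hs⟩ := h1 A
  exact ⟨A', hA, by linarith⟩

end Modularity

section RandomSubset

variable {E : Type*} [Fintype E] [DecidableEq E]

/-- The moment generating function of a weighted sum over a binomial random subset. -/
lemma sum_powerset_binomial_mul_exp (p : ℝ) (x : E → ℝ) :
    ∑ S ∈ (univ : Finset E).powerset,
        p ^ S.card * (1 - p) ^ (Fintype.card E - S.card) * Real.exp (∑ e ∈ S, x e) =
      ∏ e, (p * Real.exp (x e) + (1 - p)) := by
  rw [prod_add]
  refine sum_congr rfl fun S _ => ?_
  rw [prod_mul_distrib, prod_const, prod_const, Real.exp_sum, ← compl_eq_univ_sdiff, card_compl]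
  ring

/-- Exponential moments of the deviation of a weighted sum over a binomial random subset. -/
lemma sum_powerset_binomial_mul_exp_le {p : ℝ} (hp0 : 0 ≤ p) (hp1 : p ≤ 1) {m t : ℝ}
    {a : E → ℝ} (ha0 : ∀ e, 0 ≤ a e) (ham : ∀ e, a e ≤ m) (ht : |t| * m ≤ 1) :
    ∑ S ∈ (univ : Finset E).powerset, p ^ S.card * (1 - p) ^ (Fintype.card E - S.card) *
        Real.exp (t * (∑ e ∈ S, a e - p * ∑ e, a e)) ≤
      Real.exp (p * t ^ 2 * m * ∑ e, a e) := by
  have hsplit (S : Finset E) : Real.exp (t * (∑ e ∈ S, a e - p * ∑ e, a e)) =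
      Real.exp (∑ e ∈ S, t * a e) * Real.exp (-(p * t * ∑ e, a e)) := by
    rw [← Real.exp_add, ← mul_sum]; ring_nf
  simp only [hsplit, ← mul_assoc]
  rw [← sum_mul, sum_powerset_binomial_mul_exp]
  have hfac (e : E) : p * Real.exp (t * a e) + (1 - p) ≤
      Real.exp (p * (t * a e + t ^ 2 * m * a e)) := by
    have h1 : |t * a e| ≤ 1 := by
      rw [abs_mul, abs_of_nonneg (ha0 e)]
      exact (mul_le_mul_of_nonneg_left (ham e) (abs_nonneg t)).trans ht
    have h2 := (abs_le.1 (Real.abs_exp_sub_one_sub_id_le h1)).2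
    have h3 : (t * a e) ^ 2 ≤ t ^ 2 * m * a e := by
      have := mul_le_mul_of_nonneg_left (mul_le_mul_of_nonneg_right (ham e) (ha0 e)) (sq_nonneg t)
      linarith
    have h4 := mul_le_mul_of_nonneg_left
      (show Real.exp (t * a e) - 1 ≤ t * a e + t ^ 2 * m * a e by linarith) hp0
    linarith [Real.add_one_le_exp (p * (t * a e + t ^ 2 * m * a e))]
  have hprod : ∏ e, (p * Real.exp (t * a e) + (1 - p)) ≤
      ∏ e, Real.exp (p * (t * a e + t ^ 2 * m * a e)) :=
    prod_le_prod (fun e _ => add_nonneg (mul_nonneg hp0 (Real.exp_pos _).le)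
      (sub_nonneg.2 hp1)) fun e _ => hfac e
  refine (mul_le_mul_of_nonneg_right hprod (Real.exp_pos _).le).trans_eq ?_
  rw [← Real.exp_sum, ← Real.exp_add, ← mul_sum, sum_add_distrib, ← mul_sum, ← mul_sum]
  ring_nf

/-- A union bound over a family of weighted sums over a binomial random subset. -/
lemma sum_powerset_binomial_exists_deviation_le {p : ℝ} (hp0 : 0 ≤ p) (hp1 : p ≤ 1)
    {ι : Type*} [Fintype ι] {m T η : ℝ} (hm : 0 < m) (hη0 : 0 ≤ η) (hη : η ≤ 2)
    {a : ι → E → ℝ} (ha0 : ∀ i e, 0 ≤ a i e) (ham : ∀ i e, a i e ≤ m)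
    (haT : ∀ i, ∑ e, a i e ≤ T) :
    (∑ S ∈ (univ : Finset E).powerset,
        if ∃ i, η * (p * T) < |∑ e ∈ S, a i e - p * ∑ e, a i e| then
          p ^ S.card * (1 - p) ^ (Fintype.card E - S.card) else 0) ≤
      2 * Fintype.card ι * Real.exp (-(η ^ 2 * (p * T) / (4 * m))) := by
  set μ : Finset E → ℝ := fun S => p ^ S.card * (1 - p) ^ (Fintype.card E - S.card) with hμ
  have hμ0 (S : Finset E) : 0 ≤ μ S := mul_nonneg (pow_nonneg hp0 _)
    (pow_nonneg (sub_nonneg.2 hp1) _)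
  set d : ι → Finset E → ℝ := fun i S => ∑ e ∈ S, a i e - p * ∑ e, a i e with hd
  set t : ℝ := η / (2 * m) with ht
  have ht0 : 0 ≤ t := by positivity
  have htm : t * m ≤ 1 := by
    have : t * m = η / 2 := by rw [ht]; field_simp
    linarith
  set c : ℝ := Real.exp (-(t * (η * (p * T)))) with hc
  have hpoint (S : Finset E) : (if ∃ i, η * (p * T) < |d i S| then μ S else 0) ≤
      ∑ i, (μ S * Real.exp (t * d i S) + μ S * Real.exp (-t * d i S)) * c := by
    have hnn (i : ι) : 0 ≤ (μ S * Real.exp (t * d i S) + μ S * Real.exp (-t * d i S)) * c :=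
      mul_nonneg (add_nonneg (mul_nonneg (hμ0 S) (Real.exp_pos _).le)
        (mul_nonneg (hμ0 S) (Real.exp_pos _).le)) (Real.exp_pos _).le
    split_ifs with h
    · obtain ⟨i, hi⟩ := h
      refine le_trans ?_ (single_le_sum (fun i _ => hnn i) (mem_univ i))
      have h1 : 1 ≤ (Real.exp (t * d i S) + Real.exp (-t * d i S)) * c := by
        rw [add_mul, hc, ← Real.exp_add, ← Real.exp_add]
        rcases lt_abs.1 hi with h | h
        · have := Real.one_le_exp (x := t * d i S + -(t * (η * (p * T))))
            (by have := mul_le_mul_of_nonneg_left h.le ht0; linarith)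
          linarith [Real.exp_pos (-t * d i S + -(t * (η * (p * T))))]
        · have := Real.one_le_exp (x := -t * d i S + -(t * (η * (p * T))))
            (by have := mul_le_mul_of_nonneg_left h.le ht0; linarith)
          linarith [Real.exp_pos (t * d i S + -(t * (η * (p * T))))]
      have := mul_le_mul_of_nonneg_left h1 (hμ0 S)
      linarith
    · exact sum_nonneg fun i _ => hnn i
  have hmgf (i : ι) (s : ℝ) (hs : |s| = t) :
      ∑ S ∈ (univ : Finset E).powerset, μ S * Real.exp (s * d i S) ≤
        Real.exp (p * t ^ 2 * m * T) := by
    refine (sum_powerset_binomial_mul_exp_le hp0 hp1 (ha0 i) (ham i) (by rwa [hs])).trans ?_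
    rw [← sq_abs s, hs]
    exact Real.exp_le_exp.2 (mul_le_mul_of_nonneg_left (haT i) (by positivity))
  calc _ ≤ ∑ S ∈ (univ : Finset E).powerset,
        ∑ i, (μ S * Real.exp (t * d i S) + μ S * Real.exp (-t * d i S)) * c :=
        sum_le_sum fun S _ => hpoint S
    _ = ∑ i, (∑ S ∈ (univ : Finset E).powerset, μ S * Real.exp (t * d i S) +
          ∑ S ∈ (univ : Finset E).powerset, μ S * Real.exp (-t * d i S)) * c := by
        rw [sum_comm]
        exact sum_congr rfl fun i _ => by rw [← sum_mul, sum_add_distrib]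
    _ ≤ ∑ _i : ι, (Real.exp (p * t ^ 2 * m * T) + Real.exp (p * t ^ 2 * m * T)) * c :=
        sum_le_sum fun i _ => mul_le_mul_of_nonneg_right
          (add_le_add (hmgf i t (abs_of_nonneg ht0))
            (hmgf i (-t) (by rw [abs_neg, abs_of_nonneg ht0]))) (Real.exp_pos _).le
    _ = 2 * Fintype.card ι * (Real.exp (p * t ^ 2 * m * T) * c) := by
        rw [sum_const, card_univ, nsmul_eq_mul]; ring
    _ = _ := by
        rw [hc, ← Real.exp_add]
        congr 2
        rw [ht]; field_simp; ring

end RandomSubset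

section RandomWeight

lemma sum_pairs_le {V : Type*} [DecidableEq V] {w : V → V → ℝ} {b : ℝ} (hb : 0 ≤ b) (hwb : ∀ u v, w u v ≤ b)
    (A : Finset V) (e : Sym2 V) :
    ∑ x ∈ A ×ˢ A with s(x.1, x.2) = e, w x.1 x.2 ≤ 2 * b := by
  induction e with | _ u v
  refine (sum_le_card_nsmul _ _ b fun x _ => hwb x.1 x.2).trans ?_
  rw [nsmul_eq_mul]
  have hsub : {x ∈ A ×ˢ A | s(x.1, x.2) = s(u, v)} ⊆ ({(u, v), (v, u)} : Finset (V × V)) := by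
    rintro ⟨x, y⟩ hx
    have := (mem_filter.1 hx).2
    simpa [Sym2.eq_iff] using this
  have hcard := (card_le_card hsub).trans card_le_two
  exact mul_le_mul_of_nonneg_right (by exact_mod_cast hcard) hb

variable {V : Type} [Fintype V] [DecidableEq V]

/-- The edge weight inside a random set of pairs as a sum over unordered pairs. -/
lemma two_mul_wEdge_sym2 (w : V → V → ℝ) (S : Finset (Sym2 V)) (A : Finset V) :
    2 * wEdge (fun u v => if s(u, v) ∈ S then w u v else 0) A =
      ∑ e ∈ S, ∑ x ∈ A ×ˢ A with s(x.1, x.2) = e, w x.1 x.2 := by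
  rw [two_mul_wEdge, ← sum_product' A A fun u v => if s(u, v) ∈ S then w u v else 0,
    ← sum_filter]
  refine (sum_fiberwise_of_maps_to (t := S) (g := fun x : V × V => s(x.1, x.2))
    (fun x hx => (mem_filter.1 hx).2) _).symm.trans ?_
  refine sum_congr rfl fun e he => sum_congr ?_ fun _ _ => rfl
  ext x
  simp only [mem_filter]
  constructor
  · exact fun h => ⟨h.1.1, h.2⟩
  · exact fun h => ⟨⟨h.1, h.2 ▸ he⟩, h.2⟩

/-- With high probability the edge weights inside all vertex sets are close to `p` times the
original ones. -/
lemma one_sub_le_wProb {w : V → V → ℝ} (h0 : ∀ u v, 0 ≤ w u v) {b : ℝ} (hb : 0 < b)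
    (hwb : ∀ u v, w u v ≤ b) {p : ℝ} (hp0 : 0 ≤ p) (hp1 : p ≤ 1) {η : ℝ} (hη0 : 0 ≤ η)
    (hη : η ≤ 2) (Q : (V → V → ℝ) → Prop)
    (hQ : ∀ S : Finset (Sym2 V), (∀ A : Finset V,
      |2 * wEdge (fun u v => if s(u, v) ∈ S then w u v else 0) A - p * (2 * wEdge w A)| ≤
        η * (p * wVol w univ)) → Q fun u v => if s(u, v) ∈ S then w u v else 0) :
    1 - 2 * 2 ^ Fintype.card V * Real.exp (-(η ^ 2 * (p * wVol w univ) / (8 * b))) ≤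
      wProb w p Q := by
  obtain ⟨a, ha⟩ : ∃ a : Finset V → Sym2 V → ℝ,
      ∀ A e, a A e = ∑ x ∈ A ×ˢ A with s(x.1, x.2) = e, w x.1 x.2 := ⟨_, fun _ _ => rfl⟩
  have hsub (S : Finset (Sym2 V)) (A : Finset V) :
      ∑ e ∈ S, a A e = 2 * wEdge (fun u v => if s(u, v) ∈ S then w u v else 0) A := by
    simp only [two_mul_wEdge_sym2, ha]
  have htot (A : Finset V) : ∑ e, a A e = 2 * wEdge w A := by
    simp [hsub]
  have hdev := sum_powerset_binomial_exists_deviation_le hp0 hp1 (m := 2 * b) (by positivity)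
    hη0 hη (fun A e => (ha A e).symm ▸ sum_nonneg fun x _ => h0 _ _)
    (fun A e => (ha A e).trans_le (sum_pairs_le hb.le hwb A e))
    (fun A => (htot A).trans_le (two_mul_wEdge_le_wVol h0 A))
  simp only [htot, hsub, Fintype.card_finset] at hdev
  have hone : ∑ S ∈ (univ : Finset (Sym2 V)).powerset,
      p ^ S.card * (1 - p) ^ (Fintype.card (Sym2 V) - S.card) = 1 := by
    simpa using sum_powerset_binomial_mul_exp (E := Sym2 V) p fun _ => 0
  have hsum := sum_le_sum fun (S : Finset (Sym2 V)) (_ : S ∈ (univ : Finset (Sym2 V)).powerset) =>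
    show p ^ S.card * (1 - p) ^ (Fintype.card (Sym2 V) - S.card) ≤
      (if ∃ A : Finset V, η * (p * wVol w univ) <
          |2 * wEdge (fun u v => if s(u, v) ∈ S then w u v else 0) A - p * (2 * wEdge w A)| then
        p ^ S.card * (1 - p) ^ (Fintype.card (Sym2 V) - S.card) else 0) +
      if Q (fun u v => if s(u, v) ∈ S then w u v else 0) then
        p ^ S.card * (1 - p) ^ (Fintype.card (Sym2 V) - S.card) else 0 by
    have hμ : 0 ≤ p ^ S.card * (1 - p) ^ (Fintype.card (Sym2 V) - S.card) :=
      mul_nonneg (pow_nonneg hp0 _) (pow_nonneg (sub_nonneg.2 hp1) _)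
    by_cases h : ∃ A : Finset V, η * (p * wVol w univ) <
        |2 * wEdge (fun u v => if s(u, v) ∈ S then w u v else 0) A - p * (2 * wEdge w A)|
    · rw [if_pos h]
      split_ifs <;> linarith
    · rw [if_neg h, if_pos (hQ S fun A => not_lt.1 fun hA => h ⟨A, hA⟩), zero_add]
  rw [hone, sum_add_distrib] at hsum
  rw [wProb]
  have hcast : ((2 ^ Fintype.card V : ℕ) : ℝ) = 2 ^ Fintype.card V := by push_cast; rfl
  rw [hcast, show 4 * (2 * b) = 8 * b by ring] at hdev
  linarith

end RandomWeight

/-- Weighted analogue of Theorem 2: for every b > 0 and ε > 0 there is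
c = c(b, ε) > 0 such that for every 0 < p ≤ 1 and every b-bounded weight function w
on a finite nonempty vertex set V (symmetric, nonnegative, zero on the diagonal)
with vol_w(V)·p ≥ c·|V|, with probability at least 1 − ε the random weight
function w_p satisfies both (a) |q*(w_p) − q*(w)| < ε, and (b) for every partition
𝒜 of V there is a partition 𝒜′ whose parts are unions of parts of 𝒜 (i.e. 𝒜
refines 𝒜′) with δ_{𝒜′}(w) < δ_𝒜(w_p) + ε, where δ_𝒜(w) = q*(w) − q_𝒜(w). -/
theorem statement12 (b ε : ℝ) (hb : 0 < b) (hε : 0 < ε) :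
    ∃ c : ℝ, 0 < c ∧
      ∀ (V : Type) [Fintype V] [DecidableEq V] [Nonempty V] (w : V → V → ℝ),
        (∀ u v, w u v = w v u) → (∀ u v, 0 ≤ w u v) → (∀ v, w v v = 0) →
        (∀ u v, w u v ≤ b) →
        ∀ p : ℝ, 0 < p → p ≤ 1 → c * (Fintype.card V : ℝ) ≤ wVol w univ * p →
          1 - ε ≤ wProb w p (fun w' =>
            |wModularity w' - wModularity w| < ε ∧
            ∀ A : Finpartition (univ : Finset V),
              ∃ A' : Finpartition (univ : Finset V), A ≤ A' ∧
                wModularity w - wModScore w A' <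
                  (wModularity w' - wModScore w' A) + ε) := by
  obtain ⟨k, hk⟩ := exists_nat_gt (16 / ε)
  have hk' : (0 : ℝ) < k := (by positivity : (0 : ℝ) < 16 / ε).trans hk
  set η : ℝ := min (1 / 2) (ε / (48 * k)) with hη
  have hη0 : 0 < η := lt_min (by norm_num) (by positivity)
  have hη1 : η ≤ 1 / 2 := min_le_left _ _
  have hηk : k * (6 * η) ≤ ε / 8 := by
    have := mul_le_mul_of_nonneg_left (min_le_right (1 / 2) (ε / (48 * k)))
      (show 0 ≤ k * (6 : ℝ) by positivity)
    have h2 : k * (6 : ℝ) * (ε / (48 * k)) = ε / 8 := by field_simp; norm_num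
    rw [h2] at this
    linarith
  have hkε : 2 / (k : ℝ) ≤ ε / 8 := by
    rw [div_lt_iff₀ hε] at hk
    rw [div_le_iff₀ hk']
    linarith
  refine ⟨8 * b / η ^ 2 * (1 + 2 / ε), by positivity, ?_⟩
  intro V _ _ _ w hs h0 _ hwb p hp0 hp1 hc
  have hn : (1 : ℝ) ≤ Fintype.card V := by exact_mod_cast Fintype.card_pos
  have hD : 0 < wVol w univ * p :=
    lt_of_lt_of_le (mul_pos (by positivity) (by linarith)) hc
  have hv : 0 < wVol w univ := pos_of_mul_pos_left hD hp0.le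
  refine le_trans ?_ (one_sub_le_wProb h0 hb hwb hp0.le hp1 hη0.le (by linarith) _ ?_)
  · have hexp : (1 + 2 / ε) * Fintype.card V ≤ η ^ 2 * (p * wVol w univ) / (8 * b) := by
      rw [le_div_iff₀ (by positivity)]
      have := mul_le_mul_of_nonneg_left hc (sq_nonneg η)
      calc _ = η ^ 2 * (8 * b / η ^ 2 * (1 + 2 / ε) * Fintype.card V) := by field_simp
        _ ≤ _ := by linarith
    have h2 : (2 : ℝ) ^ Fintype.card V ≤ Real.exp (Fintype.card V) := by
      rw [← Real.exp_one_pow]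
      exact pow_le_pow_left₀ zero_le_two (by linarith [Real.add_one_le_exp (1 : ℝ)]) _
    have h3 : 2 * 2 ^ Fintype.card V * Real.exp (-(η ^ 2 * (p * wVol w univ) / (8 * b))) ≤
        2 * Real.exp (-(2 / ε)) := by
      calc _ ≤ 2 * Real.exp (Fintype.card V) * Real.exp (-((1 + 2 / ε) * Fintype.card V)) := by
            gcongr
        _ = 2 * Real.exp (-(2 / ε * Fintype.card V)) := by
            rw [mul_assoc, ← Real.exp_add]; ring_nf
        _ ≤ _ := by
            gcongr
            exact le_mul_of_one_le_right (by positivity) hn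
    have h4 : 2 * Real.exp (-(2 / ε)) ≤ ε := by
      rw [Real.exp_neg, ← div_eq_mul_inv, div_le_iff₀ (Real.exp_pos _), mul_comm ε,
        ← div_le_iff₀ hε]
      linarith [Real.add_one_le_exp (2 / ε)]
    linarith
  · intro S hS
    set w' : V → V → ℝ := fun u v => if s(u, v) ∈ S then w u v else 0 with hw'
    have h0' : ∀ u v, 0 ≤ w' u v := fun u v => by
      rw [hw']
      dsimp only
      split_ifs
      exacts [h0 u v, le_rfl]
    have hs' : ∀ u v, w' u v = w' v u := fun u v => by
      simp only [hw', hs u v, Sym2.eq_swap (a := u)]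
    have hv' : 0 < wVol w' univ := by
      have h1 := (abs_le.1 (hS univ)).1
      rw [two_mul_wEdge_univ, two_mul_wEdge_univ] at h1
      have h2 := mul_le_mul_of_nonneg_right hη1 hD.le
      linarith
    have hclose := wModularity_close h0 h0' hv hv' (by exact_mod_cast hk') hkε fun P hP =>
      (abs_wModScore_sub_le hs hs' h0 h0' hv hv' hp0 hS P).trans
        ((mul_le_mul_of_nonneg_right (by exact_mod_cast hP) (by positivity)).trans hηk)
    refine ⟨by linarith [hclose.1], fun A => ?_⟩
    obtain ⟨A', hA, h⟩ := hclose.2 A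
    exact ⟨A', hA, by linarith⟩
end

section
/- Fix ρ with 0 < ρ < 1. Modularity is estimable on graphs of density at least ρ: for every ε > 0 there exists a positive integer k such that for every graph G with at least k vertices and e(G) ≥ ρ·v(G)²/2, if X is a uniformly random k-element subset of V(G), then P( |q*(G) − q*(G[X])| > ε ) < ε, where G[X] denotes the subgraph of G induced on X. -/
open Finset
open scoped Classical

/-- The number of edges of a finite graph. -/
noncomputable def edgeCount {V : Type} [Fintype V] [DecidableEq V] (G : SimpleGraph V) : ℕ :=
  G.edgeFinset.card

/-- vol(A): the sum over vertices of A of their degree in G. -/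
noncomputable def degSum {V : Type} [Fintype V] [DecidableEq V] (G : SimpleGraph V)
    (A : Finset V) : ℕ :=
  ∑ v ∈ A, G.degree v

/-- e(A): the number of edges of G with both endpoints in A. -/
noncomputable def intEdges {V : Type} [Fintype V] [DecidableEq V] (G : SimpleGraph V)
    (A : Finset V) : ℕ :=
  (G.edgeFinset.filter (fun e => ∀ v ∈ e, v ∈ A)).card

/-- The modularity score q_𝒜(G) of a vertex partition 𝒜 of G; it is 0 if G has no edges. -/
noncomputable def modScore {V : Type} [Fintype V] [DecidableEq V] (G : SimpleGraph V)
    (P : Finpartition (univ : Finset V)) : ℝ :=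
  if edgeCount G = 0 then 0 else
    (∑ A ∈ P.parts, (intEdges G A : ℝ)) / (edgeCount G : ℝ)
      - (∑ A ∈ P.parts, (degSum G A : ℝ) ^ 2) / (4 * (edgeCount G : ℝ) ^ 2)

/-- The modularity q*(G) of a graph: the maximum of q_𝒜(G) over all vertex partitions 𝒜. -/
noncomputable def modularity {V : Type} [Fintype V] [DecidableEq V] (G : SimpleGraph V) : ℝ :=
  ⨆ P : Finpartition (univ : Finset V), modScore G P

/-- The probability that the random subgraph G_p of G (each edge of G retained
independently with probability p) satisfies the predicate Q. -/
noncomputable def subgraphProb {V : Type} [Fintype V] [DecidableEq V] (G : SimpleGraph V)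
    (p : ℝ) (Q : SimpleGraph V → Prop) : ℝ :=
  ∑ F ∈ G.edgeFinset.powerset,
    if Q (SimpleGraph.fromEdgeSet (F : Set (Sym2 V))) then
      p ^ F.card * (1 - p) ^ (G.edgeFinset.card - F.card)
    else 0

/-- The sum over closed walks of length four `x z y w` of the product of the entries of a kernel. -/
noncomputable def fourCycleSum {U : Type} [Fintype U] (E : U → U → ℝ) : ℝ :=
  ∑ x, ∑ y, (∑ z, E x z * E y z) ^ 2

/-- The average of the entries of a kernel. -/
noncomputable def density {U : Type} [Fintype U] (A : U → U → ℝ) : ℝ :=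
  (∑ x, ∑ z, A x z) / (Fintype.card U : ℝ) ^ 2

/-- The normalised weight of a kernel inside the parts of a fractional colouring. -/
noncomputable def within {U C : Type} [Fintype U] [Fintype C] (A : U → U → ℝ) (y : U → C → ℝ) :
    ℝ :=
  (∑ x, ∑ z, A x z * ∑ c, y x c * y z c) / (Fintype.card U : ℝ) ^ 2

/-- The normalised volume of a colour class of a fractional colouring. -/
noncomputable def volume {U C : Type} [Fintype U] (A : U → U → ℝ) (y : U → C → ℝ)
    (c : C) : ℝ :=
  (∑ x, ∑ z, A x z * y z c) / (Fintype.card U : ℝ) ^ 2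

/-- The modularity score of a fractional colouring. -/
noncomputable def score {U C : Type} [Fintype U] [Fintype C] (A : U → U → ℝ) (y : U → C → ℝ) :
    ℝ :=
  within A y / density A - (∑ c, volume A y c ^ 2) / density A ^ 2

/-- The proportion of points with a given type. -/
noncomputable def freq {U P : Type} [Fintype U] (φ : U → P) (p : P) : ℝ :=
  (∑ x, if φ x = p then 1 else 0) / (Fintype.card U : ℝ)

/-- Fractional colourings: each vertex carries a probability vector on the colours. -/
def IsFracColoring {U C : Type} [Fintype C] (y : U → C → ℝ) : Prop :=
  ∀ x, (∀ c, 0 ≤ y x c) ∧ ∑ c, y x c = 1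

section FourCycle

variable {U C : Type} [Fintype U] [Fintype C]

theorem sq_sum_mul_le_one {a b : C → ℝ} (ha : ∑ c, a c ^ 2 ≤ 1) (hb : ∑ c, b c ^ 2 ≤ 1) :
    (∑ c, a c * b c) ^ 2 ≤ 1 :=
  (Finset.sum_mul_sq_le_sq_mul_sq _ _ _).trans
    (mul_le_one₀ ha (Finset.sum_nonneg fun _ _ => sq_nonneg _) hb)

theorem bilinear_pow_four_le (E : U → U → ℝ) {a b : U → C → ℝ}
    (ha : ∀ x, ∑ c, a x c ^ 2 ≤ 1) (hb : ∀ x, ∑ c, b x c ^ 2 ≤ 1) :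
    (∑ x, ∑ z, E x z * ∑ c, a x c * b z c) ^ 4 ≤
      (Fintype.card U : ℝ) ^ 4 * fourCycleSum E := by
  set n : ℝ := (Fintype.card U : ℝ)
  have hn : 0 ≤ n := Nat.cast_nonneg _
  set v : U → C → ℝ := fun z c => ∑ x, E x z * a x c
  set R : ℝ := ∑ q : U × C, v q.1 q.2 ^ 2 with hR
  have hR0 : 0 ≤ R := Finset.sum_nonneg fun _ _ => sq_nonneg _
  have h1 : ∑ x, ∑ z, E x z * ∑ c, a x c * b z c = ∑ q : U × C, v q.1 q.2 * b q.1 q.2 := by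
    rw [Fintype.sum_prod_type, Finset.sum_comm]
    refine Finset.sum_congr rfl fun z _ => ?_
    simp only [v, Finset.mul_sum, Finset.sum_mul]
    rw [Finset.sum_comm]
    refine Finset.sum_congr rfl fun c _ => Finset.sum_congr rfl fun x _ => by ring
  have h2 : (∑ x, ∑ z, E x z * ∑ c, a x c * b z c) ^ 2 ≤ R * n := by
    rw [h1]
    refine (Finset.sum_mul_sq_le_sq_mul_sq _ _ _).trans ?_
    refine mul_le_mul_of_nonneg_left ?_ hR0
    rw [Fintype.sum_prod_type]
    refine (Finset.sum_le_sum fun x _ => hb x).trans ?_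
    simp [n]
  have h3 : R = ∑ q : U × U, (∑ c, a q.1 c * a q.2 c) * ∑ z, E q.1 z * E q.2 z := by
    rw [hR, Fintype.sum_prod_type, Fintype.sum_prod_type]
    simp only [v, sq, Finset.sum_mul_sum]
    have : ∀ x x' : U, ∑ c, ∑ z, a x c * a x' c * (E x z * E x' z) =
        ∑ z, ∑ c, E x z * a x c * (E x' z * a x' c) := fun x x' => by
      rw [Finset.sum_comm]
      exact Finset.sum_congr rfl fun c _ => Finset.sum_congr rfl fun x _ => by ring
    simp only [this]
    calc ∑ z, ∑ c, ∑ x, ∑ x', E x z * a x c * (E x' z * a x' c)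
        = ∑ z, ∑ x, ∑ x', ∑ c, E x z * a x c * (E x' z * a x' c) := by
          refine Finset.sum_congr rfl fun z _ => ?_
          rw [Finset.sum_comm]
          refine Finset.sum_congr rfl fun x _ => ?_
          rw [Finset.sum_comm]
      _ = ∑ x, ∑ x', ∑ z, ∑ c, E x z * a x c * (E x' z * a x' c) := by
          rw [Finset.sum_comm]
          refine Finset.sum_congr rfl fun x _ => ?_
          rw [Finset.sum_comm]
  have h4 : R ^ 2 ≤ n ^ 2 * fourCycleSum E := by
    rw [h3]
    refine (Finset.sum_mul_sq_le_sq_mul_sq _ _ _).trans ?_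
    have : ∑ q : U × U, (∑ z, E q.1 z * E q.2 z) ^ 2 = fourCycleSum E := by
      rw [Fintype.sum_prod_type, fourCycleSum]
    rw [this]
    refine mul_le_mul_of_nonneg_right ?_ ?_
    · refine (Finset.sum_le_sum fun q _ => sq_sum_mul_le_one (ha q.1) (ha q.2)).trans ?_
      simp [n, sq]
    · exact Finset.sum_nonneg fun _ _ => Finset.sum_nonneg fun _ _ => sq_nonneg _
  calc _ = ((∑ x, ∑ z, E x z * ∑ c, a x c * b z c) ^ 2) ^ 2 := by ring
    _ ≤ (R * n) ^ 2 := pow_le_pow_left₀ (sq_nonneg _) h2 2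
    _ = R ^ 2 * n ^ 2 := by ring
    _ ≤ n ^ 2 * fourCycleSum E * n ^ 2 := mul_le_mul_of_nonneg_right h4 (sq_nonneg _)
    _ = _ := by ring

theorem abs_bilinear_le {E : U → U → ℝ} {η : ℝ} (hη : 0 ≤ η)
    (hE : fourCycleSum E ≤ η ^ 4 * (Fintype.card U : ℝ) ^ 4) {a b : U → C → ℝ}
    (ha : ∀ x, ∑ c, a x c ^ 2 ≤ 1) (hb : ∀ x, ∑ c, b x c ^ 2 ≤ 1) :
    |∑ x, ∑ z, E x z * ∑ c, a x c * b z c| ≤ η * (Fintype.card U : ℝ) ^ 2 := by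
  have h := (bilinear_pow_four_le E ha hb).trans
    (mul_le_mul_of_nonneg_left hE (by positivity))
  refine le_of_pow_le_pow_left₀ (n := 4) (by norm_num) (by positivity) ?_
  rw [Even.pow_abs ⟨2, rfl⟩]
  refine h.trans_eq (by ring)

theorem sum_abs_column_le {E : U → U → ℝ} {η : ℝ} (hη : 0 ≤ η)
    (hE : fourCycleSum E ≤ η ^ 4 * (Fintype.card U : ℝ) ^ 4) :
    ∑ z, |∑ x, E x z| ≤ η * (Fintype.card U : ℝ) ^ 2 := by
  have h := abs_bilinear_le (C := Unit) hη hE (a := fun _ _ => 1)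
    (b := fun z _ => if 0 ≤ ∑ x, E x z then 1 else -1) (by simp)
    (fun z => by split_ifs <;> simp)
  refine le_trans (le_of_eq ?_) ((le_abs_self _).trans h)
  rw [Finset.sum_comm]
  refine Finset.sum_congr rfl fun z _ => ?_
  simp only [Finset.univ_unique, one_mul, Finset.sum_const, Finset.card_singleton, one_smul,
    ← Finset.sum_mul]
  split_ifs with h0
  · rw [abs_of_nonneg h0, mul_one]
  · rw [abs_of_neg (not_le.1 h0), mul_neg, mul_one]

end FourCycle

theorem IsFracColoring.sum_sq_le_one {U C : Type} [Fintype C] {y : U → C → ℝ}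
    (hy : IsFracColoring y) (x : U) : ∑ c, y x c ^ 2 ≤ 1 := by
  rw [← (hy x).2]
  refine Finset.sum_le_sum fun c _ => ?_
  have h1 : y x c ≤ 1 := by
    rw [← (hy x).2]
    exact Finset.single_le_sum (f := y x) (fun c _ => (hy x).1 c) (Finset.mem_univ c)
  nlinarith [(hy x).1 c]

theorem IsFracColoring.inner_nonneg {U C : Type} [Fintype C] {y : U → C → ℝ}
    (hy : IsFracColoring y) (x z : U) : 0 ≤ ∑ c, y x c * y z c :=
  Finset.sum_nonneg fun c _ => mul_nonneg ((hy x).1 c) ((hy z).1 c)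

theorem IsFracColoring.inner_le_one {U C : Type} [Fintype C] {y : U → C → ℝ}
    (hy : IsFracColoring y) (x z : U) : ∑ c, y x c * y z c ≤ 1 :=
  (abs_le_one_iff_mul_self_le_one.2
    (by simpa [sq] using sq_sum_mul_le_one (hy.sum_sq_le_one x) (hy.sum_sq_le_one z))
    |> abs_le.1).2

section Approximation

variable {U C : Type} [Fintype U] [Fintype C]

theorem abs_div_sq_le {s η n : ℝ} (hn : 0 < n) (h : |s| ≤ η * n ^ 2) : |s / n ^ 2| ≤ η := by
  rw [abs_div, abs_of_pos (by positivity : 0 < n ^ 2), div_le_iff₀ (by positivity)]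
  exact h

variable {A B : U → U → ℝ} {η : ℝ} {y : U → C → ℝ}

theorem abs_within_sub_le [Nonempty U] (hη : 0 ≤ η)
    (hE : fourCycleSum (fun x z => A x z - B x z) ≤ η ^ 4 * (Fintype.card U : ℝ) ^ 4)
    (hy : IsFracColoring y) : |within A y - within B y| ≤ η := by
  rw [within, within, ← sub_div]
  refine abs_div_sq_le (by exact_mod_cast Fintype.card_pos) ?_
  simpa only [sub_mul, Finset.sum_sub_distrib] using
    abs_bilinear_le hη hE hy.sum_sq_le_one hy.sum_sq_le_one

theorem abs_density_sub_le [Nonempty U] (hη : 0 ≤ η)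
    (hE : fourCycleSum (fun x z => A x z - B x z) ≤ η ^ 4 * (Fintype.card U : ℝ) ^ 4) :
    |density A - density B| ≤ η := by
  rw [density, density, ← sub_div]
  refine abs_div_sq_le (by exact_mod_cast Fintype.card_pos) ?_
  simpa [Finset.sum_sub_distrib] using
    abs_bilinear_le (C := Unit) hη hE (a := fun _ _ => 1) (b := fun _ _ => 1)
      (by simp) (by simp)

theorem sum_abs_volume_sub_le [Nonempty U] (hη : 0 ≤ η)
    (hE : fourCycleSum (fun x z => A x z - B x z) ≤ η ^ 4 * (Fintype.card U : ℝ) ^ 4)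
    (hy : IsFracColoring y) : ∑ c, |volume A y c - volume B y c| ≤ η := by
  have hn : (0 : ℝ) < Fintype.card U := by exact_mod_cast Fintype.card_pos
  have hc : ∀ c, |volume A y c - volume B y c| ≤
      (∑ z, |∑ x, (A x z - B x z)| * y z c) / (Fintype.card U : ℝ) ^ 2 := fun c => by
    rw [volume, volume, ← sub_div, abs_div, abs_of_pos (by positivity : 0 < (Fintype.card U : ℝ) ^ 2)]
    refine div_le_div_of_nonneg_right ?_ (by positivity)
    rw [← Finset.sum_sub_distrib]
    simp only [← Finset.sum_sub_distrib, ← sub_mul]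
    rw [Finset.sum_comm]
    refine (Finset.abs_sum_le_sum_abs _ _).trans (Finset.sum_le_sum fun z _ => ?_)
    rw [← Finset.sum_mul, abs_mul, abs_of_nonneg ((hy z).1 c)]
  refine (Finset.sum_le_sum fun c _ => hc c).trans ?_
  rw [← Finset.sum_div, Finset.sum_comm, div_le_iff₀ (by positivity)]
  simp only [← Finset.mul_sum, (hy _).2, mul_one]
  exact sum_abs_column_le hη hE

end Approximation

section Step

variable {U P C : Type} [Fintype U]

theorem freq_nonneg (φ : U → P) (p : P) : 0 ≤ freq φ p :=
  div_nonneg (Finset.sum_nonneg fun x _ => by split_ifs <;> norm_num) (Nat.cast_nonneg _)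

theorem sum_freq [Fintype P] [Nonempty U] (φ : U → P) : ∑ p, freq φ p = 1 := by
  simp only [freq]
  rw [← Finset.sum_div, Finset.sum_comm]
  simp

/-- `m` assigns to each type the mean of `y` over the points of that type. -/
def IsBarycenter (φ : U → P) (y : U → C → ℝ) (m : P → C → ℝ) : Prop :=
  ∀ p c, ∑ x, (if φ x = p then y x c else 0) = (∑ x, if φ x = p then 1 else 0) * m p c

theorem isBarycenter_comp (φ : U → P) (m : P → C → ℝ) :
    IsBarycenter φ (fun x => m (φ x)) m := fun p c => by
  rw [Finset.sum_mul]
  refine Finset.sum_congr rfl fun x _ => ?_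
  split_ifs with h
  · simp only [h, one_mul]
  · rw [zero_mul]

theorem exists_isBarycenter [Fintype C] [Nonempty C] (φ : U → P) {y : U → C → ℝ}
    (hy : IsFracColoring y) :
    ∃ m : P → C → ℝ, IsFracColoring m ∧ IsBarycenter φ y m := by
  obtain ⟨c₀⟩ := ‹Nonempty C›
  set k : P → ℝ := fun p => ∑ x, if φ x = p then 1 else 0 with hk
  have hk0 : ∀ p, 0 ≤ k p := fun p => Finset.sum_nonneg fun x _ => by split_ifs <;> norm_num
  refine ⟨fun p c => if k p = 0 then (if c = c₀ then 1 else 0) else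
    (∑ x, if φ x = p then y x c else 0) / k p, fun p => ?_, fun p c => ?_⟩
  · by_cases h : k p = 0
    · simp only [h, if_true]
      exact ⟨fun c => by split_ifs <;> norm_num, by simp⟩
    · simp only [h, if_false]
      refine ⟨fun c => div_nonneg (Finset.sum_nonneg fun x _ => ?_) (hk0 p), ?_⟩
      · split_ifs
        exacts [(hy x).1 c, le_rfl]
      · rw [← Finset.sum_div, Finset.sum_comm, div_eq_one_iff_eq h, hk]
        refine Finset.sum_congr rfl fun x _ => ?_
        split_ifs
        exacts [(hy x).2, by simp]
  · change _ = k p * _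
    by_cases h : k p = 0
    · simp only [h, if_true, zero_mul]
      refine Finset.sum_eq_zero fun x _ => ?_
      have := (Finset.sum_eq_zero_iff_of_nonneg (fun x _ => by split_ifs <;> norm_num)).1 h x
        (Finset.mem_univ x)
      rw [if_neg]
      intro hx
      simp [hx] at this
    · simp only [h, if_false]
      field_simp

theorem sum_step_eq [Fintype P] (φ : U → P) (S : P → P → ℝ) (a b : U → ℝ) :
    ∑ x, ∑ z, S (φ x) (φ z) * (a x * b z) =
      ∑ p, ∑ q, S p q * ((∑ x, if φ x = p then a x else 0) *
        ∑ z, if φ z = q then b z else 0) := by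
  simp only [Finset.sum_mul_sum]
  simp only [Finset.mul_sum]
  have : ∀ x z, S (φ x) (φ z) * (a x * b z) = ∑ p, ∑ q, S p q *
      ((if φ x = p then a x else 0) * if φ z = q then b z else 0) := fun x z => by simp
  simp only [this]
  calc _ = ∑ x, ∑ p, ∑ z, ∑ q, S p q *
        ((if φ x = p then a x else 0) * if φ z = q then b z else 0) :=
        Finset.sum_congr rfl fun x _ => Finset.sum_comm
    _ = ∑ p, ∑ x, ∑ z, ∑ q, S p q *
        ((if φ x = p then a x else 0) * if φ z = q then b z else 0) := Finset.sum_comm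
    _ = ∑ p, ∑ x, ∑ q, ∑ z, S p q *
        ((if φ x = p then a x else 0) * if φ z = q then b z else 0) :=
        Finset.sum_congr rfl fun p _ => Finset.sum_congr rfl fun x _ => Finset.sum_comm
    _ = _ := Finset.sum_congr rfl fun p _ => Finset.sum_comm

variable [Fintype P] {φ : U → P} {y : U → C → ℝ} {m : P → C → ℝ}

theorem density_step (S : P → P → ℝ) :
    density (fun x z => S (φ x) (φ z)) = ∑ p, ∑ q, freq φ p * freq φ q * S p q := by
  have := sum_step_eq φ S (fun _ => 1) (fun _ => 1)
  simp only [mul_one] at this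
  rw [density, this]
  simp only [freq, Finset.sum_div]
  refine Finset.sum_congr rfl fun p _ => Finset.sum_congr rfl fun q _ => ?_
  simp only [← Finset.sum_div]
  ring

theorem volume_step (S : P → P → ℝ) (h : IsBarycenter φ y m) (c : C) :
    volume (fun x z => S (φ x) (φ z)) y c =
      ∑ p, ∑ q, freq φ p * freq φ q * (S p q * m q c) := by
  have := sum_step_eq φ S (fun _ => 1) (fun z => y z c)
  simp only [one_mul, h _ c] at this
  rw [volume, this]
  simp only [freq, Finset.sum_div]
  refine Finset.sum_congr rfl fun p _ => Finset.sum_congr rfl fun q _ => ?_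
  simp only [← Finset.sum_div]
  ring

theorem within_step [Fintype C] (S : P → P → ℝ) (h : IsBarycenter φ y m) :
    within (fun x z => S (φ x) (φ z)) y =
      ∑ p, ∑ q, freq φ p * freq φ q * (S p q * ∑ c, m p c * m q c) := by
  have h1 : ∑ x, ∑ z, S (φ x) (φ z) * ∑ c, y x c * y z c =
      ∑ c, ∑ x, ∑ z, S (φ x) (φ z) * (y x c * y z c) := by
    simp only [Finset.mul_sum]
    rw [Finset.sum_comm]
    simp only [Finset.sum_comm (s := (Finset.univ : Finset U)) (t := (Finset.univ : Finset C))]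
    rw [Finset.sum_congr rfl fun c _ => Finset.sum_comm]
  have h2 : ∑ p, ∑ q, freq φ p * freq φ q * (S p q * ∑ c, m p c * m q c) =
      ∑ c, ∑ p, ∑ q, freq φ p * freq φ q * (S p q * (m p c * m q c)) := by
    simp only [Finset.mul_sum]
    rw [Finset.sum_comm]
    simp only [Finset.sum_comm (s := (Finset.univ : Finset P)) (t := (Finset.univ : Finset C))]
    rw [Finset.sum_congr rfl fun c _ => Finset.sum_comm]
  rw [within, h1, h2, Finset.sum_div]
  refine Finset.sum_congr rfl fun c _ => ?_
  rw [sum_step_eq φ S (fun x => y x c) (fun z => y z c)]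
  simp only [h _ c, freq, Finset.sum_div]
  refine Finset.sum_congr rfl fun p _ => Finset.sum_congr rfl fun q _ => ?_
  simp only [← Finset.sum_div]
  ring

end Step

section Transfer

variable {P : Type} [Fintype P]

theorem sum_abs_mul_sub_le {f g : P → ℝ} (hf : ∀ p, 0 ≤ f p) (hf1 : ∑ p, f p = 1)
    (hg : ∀ p, 0 ≤ g p) (hg1 : ∑ p, g p = 1) {τ : ℝ} (h : ∑ p, |f p - g p| ≤ τ) :
    ∑ p, ∑ q, |f p * f q - g p * g q| ≤ 2 * τ := by
  have : ∀ p q, |f p * f q - g p * g q| ≤ |f p - g p| * f q + g p * |f q - g q| := fun p q => by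
    have e : f p * f q - g p * g q = (f p - g p) * f q + g p * (f q - g q) := by ring
    rw [e]
    refine (abs_add_le _ _).trans_eq ?_
    rw [abs_mul, abs_mul, abs_of_nonneg (hf q), abs_of_nonneg (hg p)]
  refine (Finset.sum_le_sum fun p _ => Finset.sum_le_sum fun q _ => this p q).trans ?_
  simp only [Finset.sum_add_distrib, ← Finset.mul_sum, ← Finset.sum_mul, hf1, hg1]
  linarith

theorem abs_sum_sub_le {w w' s : P → P → ℝ} {τ : ℝ} (h : ∑ p, ∑ q, |w p q - w' p q| ≤ τ)
    (hs : ∀ p q, |s p q| ≤ 1) :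
    |∑ p, ∑ q, w p q * s p q - ∑ p, ∑ q, w' p q * s p q| ≤ τ := by
  simp only [← Finset.sum_sub_distrib, ← sub_mul]
  refine le_trans ?_ h
  refine (Finset.abs_sum_le_sum_abs _ _).trans (Finset.sum_le_sum fun p _ => ?_)
  refine (Finset.abs_sum_le_sum_abs _ _).trans (Finset.sum_le_sum fun q _ => ?_)
  rw [abs_mul]
  exact mul_le_of_le_one_right (abs_nonneg _) (hs p q)

theorem sum_abs_sum_sub_le {C : Type} [Fintype C] {w w' : P → P → ℝ} {s : P → P → C → ℝ} {τ : ℝ}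
    (h : ∑ p, ∑ q, |w p q - w' p q| ≤ τ) (hs : ∀ p q, ∑ c, |s p q c| ≤ 1) :
    ∑ c, |∑ p, ∑ q, w p q * s p q c - ∑ p, ∑ q, w' p q * s p q c| ≤ τ := by
  simp only [← Finset.sum_sub_distrib, ← sub_mul]
  have : ∀ c, |∑ p, ∑ q, (w p q - w' p q) * s p q c| ≤
      ∑ p, ∑ q, |w p q - w' p q| * |s p q c| := fun c => by
    refine (Finset.abs_sum_le_sum_abs _ _).trans (Finset.sum_le_sum fun p _ => ?_)
    refine (Finset.abs_sum_le_sum_abs _ _).trans (Finset.sum_le_sum fun q _ => ?_)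
    rw [abs_mul]
  refine (Finset.sum_le_sum fun c _ => this c).trans ?_
  rw [Finset.sum_comm]
  refine le_trans (Finset.sum_le_sum fun p _ => ?_) h
  rw [Finset.sum_comm]
  refine Finset.sum_le_sum fun q _ => ?_
  rw [← Finset.mul_sum]
  exact mul_le_of_le_one_right (abs_nonneg _) (hs p q)

theorem score_perturbation {r ξ N N' D D' t t' : ℝ} (hr : 0 < r) (ht : r ≤ t) (ht' : r ≤ t')
    (ht1 : t ≤ 1) (ht1' : t' ≤ 1) (hN0 : 0 ≤ N) (hN1 : N ≤ 1) (hD0 : 0 ≤ D) (hD1 : D ≤ 1)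
    (hN : |N' - N| ≤ ξ) (hD : |D' - D| ≤ 2 * ξ) (htt : |t' - t| ≤ ξ) :
    N' / t' - D' / t' ^ 2 ≤ N / t - D / t ^ 2 +
      (1 / r + 1 / r ^ 2 + 2 / r ^ 2 + 2 / r ^ 4) * ξ := by
  have p : 0 < t := hr.trans_le ht
  have p' : 0 < t' := hr.trans_le ht'
  have hξ : 0 ≤ ξ := (abs_nonneg _).trans hN
  rw [abs_le] at hN hD htt
  have h1 : N' / t' ≤ N / t' + 1 / r * ξ := by
    have : N' / t' - N / t' ≤ ξ / r := by
      rw [← sub_div]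
      exact div_le_div₀ hξ hN.2 hr ht'
    have e : 1 / r * ξ = ξ / r := by ring
    linarith
  have h2 : N / t' ≤ N / t + 1 / r ^ 2 * ξ := by
    have e : N / t' - N / t = N * (t - t') / (t' * t) := by field_simp
    have : N * (t - t') / (t' * t) ≤ ξ / r ^ 2 := by
      refine div_le_div₀ hξ ?_ (by positivity) (by nlinarith)
      nlinarith
    have e : 1 / r ^ 2 * ξ = ξ / r ^ 2 := by ring
    linarith
  have h3 : D / t' ^ 2 ≤ D' / t' ^ 2 + 2 / r ^ 2 * ξ := by
    have : D / t' ^ 2 - D' / t' ^ 2 ≤ 2 * ξ / r ^ 2 := by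
      rw [← sub_div]
      exact div_le_div₀ (by positivity) (by linarith) (by positivity)
        (pow_le_pow_left₀ hr.le ht' 2)
    have e : 2 / r ^ 2 * ξ = 2 * ξ / r ^ 2 := by ring
    linarith
  have h4 : D / t ^ 2 ≤ D / t' ^ 2 + 2 / r ^ 4 * ξ := by
    have e : D / t ^ 2 - D / t' ^ 2 = D * ((t' - t) * (t' + t)) / (t' ^ 2 * t ^ 2) := by
      field_simp
      ring
    have h5 : (t' - t) * (t' + t) ≤ 2 * ξ := by nlinarith
    have : D * ((t' - t) * (t' + t)) / (t' ^ 2 * t ^ 2) ≤ 2 * ξ / r ^ 4 := by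
      refine div_le_div₀ (by positivity) ?_ (by positivity) ?_
      · nlinarith
      · calc r ^ 4 = r ^ 2 * r ^ 2 := by ring
          _ ≤ t' ^ 2 * t ^ 2 := mul_le_mul (pow_le_pow_left₀ hr.le ht' 2)
              (pow_le_pow_left₀ hr.le ht 2) (by positivity) (by positivity)
    have e : 2 / r ^ 4 * ξ = 2 * ξ / r ^ 4 := by ring
    linarith
  linarith

theorem abs_sum_sq_sub_le {C : Type} [Fintype C] {u v : C → ℝ} {ξ : ℝ}
    (hu : ∀ c, 0 ≤ u c ∧ u c ≤ 1) (hv : ∀ c, 0 ≤ v c ∧ v c ≤ 1) (h : ∑ c, |u c - v c| ≤ ξ) :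
    |∑ c, u c ^ 2 - ∑ c, v c ^ 2| ≤ 2 * ξ := by
  rw [← Finset.sum_sub_distrib]
  refine (Finset.abs_sum_le_sum_abs _ _).trans ?_
  refine le_trans (Finset.sum_le_sum fun c _ => ?_)
    ((Finset.mul_sum _ _ _).symm.le.trans (mul_le_mul_of_nonneg_left h zero_le_two))
  rw [show u c ^ 2 - v c ^ 2 = (u c + v c) * (u c - v c) by ring, abs_mul]
  refine mul_le_mul_of_nonneg_right ?_ (abs_nonneg _)
  rw [abs_le]
  constructor <;> linarith [hu c, hv c]

end Transfer

section Bounds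

variable {U C : Type} [Fintype U] [Fintype C] {A : U → U → ℝ} {y : U → C → ℝ}

theorem div_card_sq_le_one {f : U → U → ℝ} (hf : ∀ x z, f x z ≤ 1) :
    (∑ x, ∑ z, f x z) / (Fintype.card U : ℝ) ^ 2 ≤ 1 := by
  refine div_le_one_of_le₀ ?_ (by positivity)
  refine (Finset.sum_le_sum fun x _ => Finset.sum_le_sum fun z _ => hf x z).trans ?_
  simp [sq]

theorem density_le_one (hA : ∀ x z, 0 ≤ A x z ∧ A x z ≤ 1) : density A ≤ 1 :=
  div_card_sq_le_one fun x z => (hA x z).2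

theorem within_nonneg (hA : ∀ x z, 0 ≤ A x z ∧ A x z ≤ 1) (hy : IsFracColoring y) :
    0 ≤ within A y :=
  div_nonneg (Finset.sum_nonneg fun x _ => Finset.sum_nonneg fun z _ =>
    mul_nonneg (hA x z).1 (hy.inner_nonneg x z)) (by positivity)

theorem within_le_one (hA : ∀ x z, 0 ≤ A x z ∧ A x z ≤ 1) (hy : IsFracColoring y) :
    within A y ≤ 1 :=
  div_card_sq_le_one fun x z => mul_le_one₀ (hA x z).2 (hy.inner_nonneg x z) (hy.inner_le_one x z)

theorem volume_nonneg (hA : ∀ x z, 0 ≤ A x z ∧ A x z ≤ 1) (hy : IsFracColoring y) (c : C) :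
    0 ≤ volume A y c :=
  div_nonneg (Finset.sum_nonneg fun x _ => Finset.sum_nonneg fun z _ =>
    mul_nonneg (hA x z).1 ((hy z).1 c)) (by positivity)

theorem sum_volume (hy : IsFracColoring y) : ∑ c, volume A y c = density A := by
  simp only [volume, density]
  rw [← Finset.sum_div, Finset.sum_comm]
  congr 1
  refine Finset.sum_congr rfl fun x _ => ?_
  rw [Finset.sum_comm]
  simp only [← Finset.mul_sum, (hy _).2, mul_one]

theorem volume_le_one (hA : ∀ x z, 0 ≤ A x z ∧ A x z ≤ 1) (hy : IsFracColoring y) (c : C) :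
    volume A y c ≤ 1 := by
  refine le_trans ?_ (density_le_one hA)
  rw [← sum_volume hy]
  exact Finset.single_le_sum (f := volume A y) (fun c _ => volume_nonneg hA hy c)
    (Finset.mem_univ c)

theorem sum_sq_volume_le_one (hA : ∀ x z, 0 ≤ A x z ∧ A x z ≤ 1) (hy : IsFracColoring y) :
    ∑ c, volume A y c ^ 2 ≤ 1 := by
  refine le_trans ?_ (density_le_one hA)
  rw [← sum_volume hy]
  refine Finset.sum_le_sum fun c _ => ?_
  nlinarith [volume_nonneg hA hy c, volume_le_one hA hy c]

end Bounds

theorem exists_score_le {U₁ U₂ P C : Type} [Fintype U₁] [Fintype U₂] [Nonempty U₁] [Nonempty U₂]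
    [Fintype P] [Fintype C] [Nonempty C] {A₁ : U₁ → U₁ → ℝ} {A₂ : U₂ → U₂ → ℝ}
    (hA₁ : ∀ x z, 0 ≤ A₁ x z ∧ A₁ x z ≤ 1) (hA₂ : ∀ x z, 0 ≤ A₂ x z ∧ A₂ x z ≤ 1)
    {φ₁ : U₁ → P} {φ₂ : U₂ → P} {S : P → P → ℝ} (hS : ∀ p q, 0 ≤ S p q ∧ S p q ≤ 1)
    {η τ r : ℝ} (hη : 0 ≤ η) (hr : 0 < r)
    (h₁ : fourCycleSum (fun x z => A₁ x z - S (φ₁ x) (φ₁ z)) ≤ η ^ 4 * (Fintype.card U₁ : ℝ) ^ 4)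
    (h₂ : fourCycleSum (fun x z => A₂ x z - S (φ₂ x) (φ₂ z)) ≤ η ^ 4 * (Fintype.card U₂ : ℝ) ^ 4)
    (hτ : ∑ p, |freq φ₂ p - freq φ₁ p| ≤ τ) (hr₁ : r ≤ density A₁) (hr₂ : r ≤ density A₂)
    {y : U₂ → C → ℝ} (hy : IsFracColoring y) :
    ∃ y' : U₁ → C → ℝ, IsFracColoring y' ∧ score A₂ y ≤ score A₁ y' +
      (1 / r + 1 / r ^ 2 + 2 / r ^ 2 + 2 / r ^ 4) * (2 * η + 2 * τ) := by
  obtain ⟨m, hm, hb⟩ := exists_isBarycenter φ₂ hy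
  have hw := sum_abs_mul_sub_le (freq_nonneg φ₂) (sum_freq φ₂) (freq_nonneg φ₁) (sum_freq φ₁) hτ
  have hb₁ := isBarycenter_comp φ₁ m
  have hy' : IsFracColoring fun x => m (φ₁ x) := fun x => hm (φ₁ x)
  have tri : ∀ a b c d : ℝ, |a - d| ≤ |a - b| + |b - c| + |d - c| := fun a b c d => by
    rw [abs_sub_comm d c]
    exact (abs_sub_le a c d).trans (add_le_add_left (abs_sub_le a b c) _)
  refine ⟨fun x => m (φ₁ x), hy', ?_⟩
  refine score_perturbation hr hr₁ hr₂ (density_le_one hA₁) (density_le_one hA₂)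
    (within_nonneg hA₁ hy') (within_le_one hA₁ hy') (Finset.sum_nonneg fun c _ => sq_nonneg _)
    (sum_sq_volume_le_one hA₁ hy') ?_ (abs_sum_sq_sub_le
      (fun c => ⟨volume_nonneg hA₂ hy c, volume_le_one hA₂ hy c⟩)
      (fun c => ⟨volume_nonneg hA₁ hy' c, volume_le_one hA₁ hy' c⟩) ?_) ?_
  · refine tri _ (within (fun x z => S (φ₂ x) (φ₂ z)) y)
      (within (fun x z => S (φ₁ x) (φ₁ z)) fun x => m (φ₁ x)) _ |>.trans ?_
    have := abs_sum_sub_le hw (s := fun p q => S p q * ∑ c, m p c * m q c) fun p q => by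
      rw [abs_of_nonneg (mul_nonneg (hS p q).1 (hm.inner_nonneg p q))]
      exact mul_le_one₀ (hS p q).2 (hm.inner_nonneg p q) (hm.inner_le_one p q)
    rw [← within_step S hb, ← within_step S hb₁] at this
    linarith [abs_within_sub_le hη h₂ hy, abs_within_sub_le hη h₁ hy']
  · refine (Finset.sum_le_sum fun c _ => tri _ (volume (fun x z => S (φ₂ x) (φ₂ z)) y c)
      (volume (fun x z => S (φ₁ x) (φ₁ z)) (fun x => m (φ₁ x)) c) _).trans ?_
    have := sum_abs_sum_sub_le hw (s := fun p q c => S p q * m q c) fun p q => by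
      simp only [abs_of_nonneg (mul_nonneg (hS p q).1 ((hm q).1 _)), ← Finset.mul_sum, (hm q).2,
        mul_one]
      exact (hS p q).2
    simp only [← volume_step S hb, ← volume_step S hb₁] at this
    simp only [Finset.sum_add_distrib]
    linarith [sum_abs_volume_sub_le hη h₂ hy, sum_abs_volume_sub_le hη h₁ hy']
  · refine tri _ (density fun x z => S (φ₂ x) (φ₂ z))
      (density fun x z => S (φ₁ x) (φ₁ z)) _ |>.trans ?_
    have := abs_sum_sub_le hw (s := S) fun p q => by
      rw [abs_of_nonneg (hS p q).1]
      exact (hS p q).2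
    rw [← density_step S, ← density_step S] at this
    linarith [abs_density_sub_le hη h₂, abs_density_sub_le hη h₁]

section Rounding

variable {U C : Type} [Fintype C]

theorem exists_rounded_on [Fintype U] [Nonempty C] {W : U → U → ℝ} (hW : ∀ x, W x x = 0)
    {y : U → C → ℝ}
    (hy : IsFracColoring y) (s : Finset U) :
    ∃ y' : U → C → ℝ, IsFracColoring y' ∧ (∀ x ∈ s, ∃ c, y' x = Pi.single c 1) ∧
      ∑ x, ∑ z, W x z * ∑ c, y x c * y z c ≤ ∑ x, ∑ z, W x z * ∑ c, y' x c * y' z c := by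
  induction s using Finset.induction_on with
  | empty => exact ⟨y, hy, by simp, le_rfl⟩
  | insert a s ha ih =>
    obtain ⟨y', hy', hs, hle⟩ := ih
    set Q : (U → C → ℝ) → ℝ := fun y => ∑ x, ∑ z, W x z * ∑ c, y x c * y z c with hQ
    set Y : C → U → C → ℝ := fun c => Function.update y' a (Pi.single c 1) with hYdef
    have hterm : ∀ x z, W x z * ∑ c, y' x c * y' z c =
        ∑ c, y' a c * (W x z * ∑ c', Y c x c' * Y c z c') := by
      intro x z
      by_cases hx : x = a
      · by_cases hz : z = a
        · simp [hx, hz, hW]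
        · subst hx
          simp only [hYdef, Function.update_self, Function.update_of_ne hz, Pi.single_apply,
            ite_mul, one_mul, zero_mul, Finset.sum_ite_eq', Finset.mem_univ, if_true,
            Finset.mul_sum]
          exact Finset.sum_congr rfl fun c _ => by ring
      · by_cases hz : z = a
        · subst hz
          simp only [hYdef, Function.update_self, Function.update_of_ne hx, Pi.single_apply,
            mul_ite, mul_one, mul_zero, Finset.sum_ite_eq', Finset.mem_univ, if_true,
            Finset.mul_sum]
          exact Finset.sum_congr rfl fun c _ => by ring
        · simp only [hYdef, Function.update_of_ne hx, Function.update_of_ne hz, ← Finset.sum_mul,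
            (hy' a).2, one_mul]
    have havg : Q y' = ∑ c, y' a c * Q (Y c) := by
      simp only [hQ, hterm, Finset.mul_sum (s := (Finset.univ : Finset U))]
      rw [Finset.sum_comm' (s := (Finset.univ : Finset C)) (t := fun _ => (Finset.univ : Finset U))
        (t' := (Finset.univ : Finset U)) (s' := fun _ => (Finset.univ : Finset C)) (by simp)]
      exact Finset.sum_congr rfl fun x _ => Finset.sum_comm
    obtain ⟨c, hc⟩ : ∃ c, Q y' ≤ Q (Y c) := by
      by_contra! h
      have h0 : ∑ c, y' a c * Q (Y c) < ∑ c, y' a c * Q y' := by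
        refine Finset.sum_lt_sum
          (fun c _ => mul_le_mul_of_nonneg_left (h c).le ((hy' a).1 c)) ?_
        by_contra! h1
        have : ∀ c, y' a c = 0 := fun c => by
          by_contra h2
          have := (hy' a).1 c
          have h3 := h1 c (Finset.mem_univ c)
          have h4 : 0 < y' a c := lt_of_le_of_ne this (Ne.symm h2)
          exact absurd (le_of_mul_le_mul_left h3 h4) (not_le.2 (h c))
        have h5 := (hy' a).2
        simp [this] at h5
      rw [← havg, ← Finset.sum_mul, (hy' a).2, one_mul] at h0
      exact lt_irrefl _ h0
    refine ⟨Y c, fun x => ?_, fun x hx => ?_, hle.trans hc⟩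
    · by_cases hx : x = a
      · subst hx
        simp only [hYdef, Function.update_self]
        refine ⟨fun c' => ?_, by simp⟩
        rw [Pi.single_apply]
        split_ifs <;> norm_num
      · simpa only [hYdef, Function.update_of_ne hx] using hy' x
    · by_cases hxa : x = a
      · exact ⟨c, by simp [hYdef, hxa]⟩
      · obtain ⟨c', hc'⟩ := hs x (Finset.mem_of_mem_insert_of_ne hx hxa)
        exact ⟨c', by simp [hYdef, Function.update_of_ne hxa, hc']⟩

/-- The fractional colouring given by a colouring. -/
noncomputable def ofColoring (σ : U → C) (x : U) : C → ℝ := Pi.single (σ x) 1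

theorem isFracColoring_ofColoring (σ : U → C) : IsFracColoring (ofColoring σ) := fun x => by
  refine ⟨fun c => ?_, by simp [ofColoring]⟩
  rw [ofColoring, Pi.single_apply]
  split_ifs <;> norm_num

variable [Fintype U]

theorem exists_coloring_le [Nonempty C] {W : U → U → ℝ} {b : ℝ}
    (hW : ∀ x, -b ≤ W x x ∧ W x x ≤ 0) {y : U → C → ℝ} (hy : IsFracColoring y) :
    ∃ σ : U → C, ∑ x, ∑ z, W x z * ∑ c, y x c * y z c ≤
      ∑ x, ∑ z, W x z * ∑ c, ofColoring σ x c * ofColoring σ z c + Fintype.card U * b := by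
  set W₀ : U → U → ℝ := fun x z => if x = z then 0 else W x z with hW₀
  have hsplit : ∀ w : U → C → ℝ, ∑ x, ∑ z, W x z * ∑ c, w x c * w z c =
      ∑ x, ∑ z, W₀ x z * ∑ c, w x c * w z c + ∑ x, W x x * ∑ c, w x c * w x c := fun w => by
    rw [← Finset.sum_add_distrib]
    refine Finset.sum_congr rfl fun x _ => ?_
    have : W x x * ∑ c, w x c * w x c =
        ∑ z, if x = z then W x z * ∑ c, w x c * w z c else 0 := by simp
    rw [this, ← Finset.sum_add_distrib]
    refine Finset.sum_congr rfl fun z _ => ?_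
    simp only [hW₀]
    split_ifs <;> simp
  obtain ⟨y', hy', hs, hle⟩ :=
    exists_rounded_on (W := W₀) (fun x => by simp [hW₀]) hy Finset.univ
  choose σ hσ using fun x => hs x (Finset.mem_univ x)
  have hyσ : y' = ofColoring σ := funext hσ
  subst hyσ
  refine ⟨σ, ?_⟩
  rw [hsplit y, hsplit (ofColoring σ)]
  have h1 : ∑ x, W x x * ∑ c, y x c * y x c ≤ 0 :=
    Finset.sum_nonpos fun x _ => mul_nonpos_of_nonpos_of_nonneg (hW x).2 (hy.inner_nonneg x x)
  have h2 : -(Fintype.card U * b) ≤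
      ∑ x, W x x * ∑ c, ofColoring σ x c * ofColoring σ x c := by
    have : ∀ x, ∑ c, ofColoring σ x c * ofColoring σ x c = 1 := fun x => by
      simp [ofColoring, Pi.single_apply]
    simp only [this, mul_one]
    refine le_trans (le_of_eq ?_) (Finset.sum_le_sum fun x _ => (hW x).1)
    simp
  linarith

theorem sum_sq_linear_eq (d : U → ℝ) (y : U → C → ℝ) :
    ∑ c, (∑ z, d z * y z c) ^ 2 = ∑ x, ∑ z, d x * d z * ∑ c, y x c * y z c := by
  simp only [sq, Finset.sum_mul_sum, Finset.mul_sum (s := (Finset.univ : Finset C))]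
  rw [Finset.sum_comm]
  refine Finset.sum_congr rfl fun x _ => ?_
  rw [Finset.sum_comm]
  exact Finset.sum_congr rfl fun z _ => Finset.sum_congr rfl fun c _ => by ring

theorem score_eq (A : U → U → ℝ) (y : U → C → ℝ) :
    score A y = ∑ x, ∑ z, (A x z / ((Fintype.card U : ℝ) ^ 2 * density A) -
      (∑ w, A w x) * (∑ w, A w z) / ((Fintype.card U : ℝ) ^ 4 * density A ^ 2)) *
        ∑ c, y x c * y z c := by
  have hv : ∑ c, volume A y c ^ 2 = (∑ x, ∑ z, (∑ w, A w x) * (∑ w, A w z) *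
      ∑ c, y x c * y z c) / (Fintype.card U : ℝ) ^ 4 := by
    have h1 : ∀ c, volume A y c = (∑ z, (∑ w, A w z) * y z c) / (Fintype.card U : ℝ) ^ 2 :=
      fun c => by
        rw [volume, Finset.sum_comm]
        simp only [Finset.sum_mul]
    simp only [h1, div_pow]
    rw [← Finset.sum_div, ← pow_mul, sum_sq_linear_eq]
  rw [score, hv, within, div_div, div_div]
  simp only [sub_mul, Finset.sum_sub_distrib, Finset.sum_div]
  congr 1 <;> exact Finset.sum_congr rfl fun x _ => Finset.sum_congr rfl fun z _ => by ring

theorem exists_coloring_score [Nonempty U] [Nonempty C] {A : U → U → ℝ}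
    (hA : ∀ x z, 0 ≤ A x z ∧ A x z ≤ 1) (hd : ∀ x, A x x = 0) {r : ℝ} (hr : 0 < r)
    (hrA : r ≤ density A) {y : U → C → ℝ} (hy : IsFracColoring y) :
    ∃ σ : U → C, score A y ≤ score A (ofColoring σ) + 1 / (r ^ 2 * Fintype.card U) := by
  have hn : (0 : ℝ) < Fintype.card U := by exact_mod_cast Fintype.card_pos
  set n : ℝ := (Fintype.card U : ℝ) with hn_def
  have ht : 0 < density A := hr.trans_le hrA
  obtain ⟨σ, hσ⟩ := exists_coloring_le (b := 1 / (r ^ 2 * n ^ 2))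
    (W := fun x z => A x z / (n ^ 2 * density A) -
      (∑ w, A w x) * (∑ w, A w z) / (n ^ 4 * density A ^ 2)) (fun x => by
      have h0 : 0 ≤ ∑ w, A w x := Finset.sum_nonneg fun w _ => (hA w x).1
      have h1 : ∑ w, A w x ≤ n := by
        refine (Finset.sum_le_sum fun w _ => (hA w x).2).trans ?_
        simp [n]
      simp only [hd, zero_div, zero_sub, neg_le_neg_iff]
      refine ⟨?_, neg_nonpos.2 (by positivity)⟩
      rw [div_le_div_iff₀ (by positivity) (by positivity)]
      have h2 : (∑ w, A w x) * (∑ w, A w x) ≤ n * n := mul_le_mul h1 h1 h0 hn.le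
      have h3 : r ^ 2 ≤ density A ^ 2 := pow_le_pow_left₀ hr.le hrA 2
      calc _ ≤ n * n * (density A ^ 2 * n ^ 2) :=
            mul_le_mul h2 (mul_le_mul_of_nonneg_right h3 (by positivity)) (by positivity)
              (by positivity)
        _ = _ := by ring) hy
  refine ⟨σ, ?_⟩
  rw [score_eq, score_eq]
  refine hσ.trans_eq ?_
  congr 1
  rw [← hn_def]
  field_simp

end Rounding

/-- The adjacency kernel of a graph. -/
noncomputable def adj {U : Type} (G : SimpleGraph U) (x z : U) : ℝ := if G.Adj x z then 1 else 0

section Modularity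

variable {U : Type}

theorem adj_mem (G : SimpleGraph U) (x z : U) : 0 ≤ adj G x z ∧ adj G x z ≤ 1 := by
  rw [adj]
  split_ifs <;> norm_num

theorem adj_self (G : SimpleGraph U) (x : U) : adj G x x = 0 := by simp [adj]

theorem adj_comm (G : SimpleGraph U) (x z : U) : adj G x z = adj G z x := by
  simp [adj, G.adj_comm]

variable [Fintype U]

theorem degree_eq_sum_adj (G : SimpleGraph U) (x : U) : (G.degree x : ℝ) = ∑ z, adj G x z := by
  simp [adj, ← SimpleGraph.card_neighborFinset_eq_degree, SimpleGraph.neighborFinset_eq_filter]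

variable [DecidableEq U]

theorem two_mul_edgeCount (G : SimpleGraph U) :
    2 * (edgeCount G : ℝ) = ∑ x, ∑ z, adj G x z := by
  simp only [← degree_eq_sum_adj, edgeCount]
  exact_mod_cast G.sum_degrees_eq_twice_card_edges.symm

theorem two_mul_intEdges (G : SimpleGraph U) (s : Finset U) :
    2 * (intEdges G s : ℝ) = ∑ x ∈ s, ∑ z ∈ s, adj G x z := by
  let H : SimpleGraph U :=
    { Adj := fun x z => G.Adj x z ∧ x ∈ s ∧ z ∈ s
      symm := ⟨fun x z h => ⟨h.1.symm, h.2.2, h.2.1⟩⟩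
      loopless := ⟨fun x h => G.loopless.irrefl x h.1⟩ }
  have h1 : intEdges G s = edgeCount H := by
    rw [intEdges, edgeCount]
    congr 1
    ext e
    induction e with
    | _ x z => simp [H]
  have h2 : ∑ x ∈ s, ∑ z ∈ s, adj G x z =
      ∑ x, if x ∈ s then ∑ z, (if z ∈ s then adj G x z else 0) else 0 := by
    simp [Finset.sum_ite_mem]
  rw [h1, two_mul_edgeCount, h2]
  refine Finset.sum_congr rfl fun x _ => ?_
  by_cases hx : x ∈ s
  · rw [if_pos hx]
    refine Finset.sum_congr rfl fun z _ => ?_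
    by_cases hz : z ∈ s <;> simp [adj, H, hx, hz]
  · simp [adj, H, hx]

theorem degSum_eq (G : SimpleGraph U) (s : Finset U) :
    (degSum G s : ℝ) = ∑ x, ∑ z ∈ s, adj G x z := by
  rw [degSum, Finset.sum_comm]
  push_cast
  simp only [degree_eq_sum_adj]
  exact Finset.sum_congr rfl fun z _ => Finset.sum_congr rfl fun x _ => adj_comm G z x

theorem edgeCount_ne_zero {G : SimpleGraph U} (h : 0 < density (adj G)) : edgeCount G ≠ 0 := by
  intro h0
  rw [density, ← two_mul_edgeCount, h0] at h
  simp at h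

/-- The contribution of one part to the modularity score. -/
noncomputable def partScore (G : SimpleGraph U) (s : Finset U) : ℝ :=
  (intEdges G s : ℝ) / (edgeCount G : ℝ) - (degSum G s : ℝ) ^ 2 / (4 * (edgeCount G : ℝ) ^ 2)

theorem partScore_empty (G : SimpleGraph U) : partScore G ∅ = 0 := by
  have := two_mul_intEdges G ∅
  have h : (intEdges G ∅ : ℝ) = 0 := by simpa using this
  simp [partScore, h, degSum]

theorem score_ofColoring {C : Type} [Fintype C] {G : SimpleGraph U} (h : 0 < density (adj G))
    (σ : U → C) :
    score (adj G) (ofColoring σ) = ∑ c, partScore G (Finset.univ.filter fun x => σ x = c) := by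
  have hm : (edgeCount G : ℝ) ≠ 0 := by exact_mod_cast edgeCount_ne_zero h
  have hn : (Fintype.card U : ℝ) ≠ 0 := fun h0 => by
    rw [density, h0] at h
    simp at h
  have hW : within (adj G) (ofColoring σ) =
      (∑ c, 2 * (intEdges G (Finset.univ.filter fun x => σ x = c) : ℝ)) /
        (Fintype.card U : ℝ) ^ 2 := by
    rw [within]
    congr 1
    simp only [two_mul_intEdges, Finset.sum_filter]
    have e : ∀ x z, adj G x z * ∑ c, ofColoring σ x c * ofColoring σ z c =
        ∑ c, if σ x = c then (if σ z = c then adj G x z else 0) else 0 := fun x z => by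
      simp [ofColoring, Pi.single_apply, eq_comm]
    simp only [e]
    rw [Finset.sum_congr rfl fun x _ => Finset.sum_comm, Finset.sum_comm]
    refine Finset.sum_congr rfl fun c _ => Finset.sum_congr rfl fun x _ => ?_
    split_ifs <;> simp
  have hV : ∀ c, volume (adj G) (ofColoring σ) c =
      (degSum G (Finset.univ.filter fun x => σ x = c) : ℝ) / (Fintype.card U : ℝ) ^ 2 := fun c => by
    rw [volume, degSum_eq]
    congr 1
    refine Finset.sum_congr rfl fun x _ => ?_
    simp [ofColoring, Pi.single_apply, Finset.sum_filter, eq_comm]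
  have hD : density (adj G) = 2 * (edgeCount G : ℝ) / (Fintype.card U : ℝ) ^ 2 := by
    rw [density, two_mul_edgeCount]
  rw [score, hW, hD]
  simp only [hV, partScore, Finset.sum_sub_distrib, div_pow, ← Finset.sum_div, ← Finset.mul_sum]
  field_simp
  ring

theorem sum_parts_eq_sum_fibers {C : Type} [Fintype C] (P : Finpartition (univ : Finset U))
    (σ : U → C) (hσ : ∀ x, Finset.univ.filter (fun z => σ z = σ x) = P.part x)
    (F : Finset U → ℝ) (hF : F ∅ = 0) :
    ∑ s ∈ P.parts, F s = ∑ c, F (Finset.univ.filter fun x => σ x = c) := by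
  have hpos : ∀ x, ((P.part x).card : ℝ) ≠ 0 := fun x => by
    exact_mod_cast (Finset.card_pos.2 ⟨x, P.mem_part (Finset.mem_univ x)⟩).ne'
  have hl : ∑ s ∈ P.parts, F s = ∑ x, F (P.part x) / (P.part x).card := by
    have : P.parts = Finset.univ.image P.part := by
      ext s
      constructor
      · intro hs
        obtain ⟨x, hx⟩ := P.nonempty_of_mem_parts hs
        exact Finset.mem_image.2 ⟨x, Finset.mem_univ x, P.part_eq_of_mem hs hx⟩
      · intro hs
        obtain ⟨x, -, rfl⟩ := Finset.mem_image.1 hs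
        exact P.part_mem.2 (Finset.mem_univ x)
    rw [this]
    refine Finset.sum_image' _ fun x _ => ?_
    have hfil : (Finset.univ.filter fun z => P.part z = P.part x) = P.part x := by
      ext z
      simp [P.mem_part_iff_part_eq_part (Finset.mem_univ z) (Finset.mem_univ x)]
    rw [Finset.sum_congr rfl (g := fun _ => F (P.part x) / (P.part x).card) fun z hz => by
      rw [(Finset.mem_filter.1 hz).2], hfil, Finset.sum_const, nsmul_eq_mul]
    field_simp [hpos x]
  have hr : ∑ c, F (Finset.univ.filter fun x => σ x = c) =
      ∑ x, F (P.part x) / (P.part x).card := by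
    rw [← Finset.sum_subset (Finset.subset_univ (Finset.univ.image σ)) fun c _ hc => by
      rw [Finset.filter_false_of_mem, hF]
      exact fun x _ hx => hc (Finset.mem_image.2 ⟨x, Finset.mem_univ x, hx⟩)]
    refine Finset.sum_image' _ fun x _ => ?_
    have hpart : ∀ z, σ z = σ x → P.part z = P.part x := fun z hz => by
      rw [← hσ z, ← hσ x, hz]
    rw [Finset.sum_congr rfl (g := fun _ => F (P.part x) / (P.part x).card) fun z hz => by
      rw [hpart z (Finset.mem_filter.1 hz).2], hσ x, Finset.sum_const, nsmul_eq_mul]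
    field_simp [hpos x]
  rw [hl, hr]

theorem modScore_eq_score {C : Type} [Fintype C] {G : SimpleGraph U} (h : 0 < density (adj G))
    (P : Finpartition (univ : Finset U)) (σ : U → C)
    (hσ : ∀ x, Finset.univ.filter (fun z => σ z = σ x) = P.part x) :
    modScore G P = score (adj G) (ofColoring σ) := by
  rw [score_ofColoring h, ← sum_parts_eq_sum_fibers P σ hσ _ (partScore_empty G), modScore,
    if_neg (edgeCount_ne_zero h)]
  simp only [partScore, Finset.sum_sub_distrib, Finset.sum_div]

theorem score_ofColoring_le_modularity {C : Type} [Fintype C] {G : SimpleGraph U}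
    (h : 0 < density (adj G)) (σ : U → C) : score (adj G) (ofColoring σ) ≤ modularity G := by
  rw [← modScore_eq_score h (Finpartition.ofSetoid (Setoid.ker σ)) σ fun x => by
    ext z
    simp [Finpartition.mem_part_ofSetoid_iff_rel, Setoid.ker_def, eq_comm]]
  exact le_ciSup (Set.finite_range _).bddAbove _

theorem modularity_le {G : SimpleGraph U} (h : 0 < density (adj G)) {b : ℝ}
    (hb : ∀ σ : U → Finset U, score (adj G) (ofColoring σ) ≤ b) : modularity G ≤ b := by
  refine ciSup_le fun P => ?_
  rw [modScore_eq_score h P P.part fun x => by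
    ext z
    simp [P.mem_part_iff_part_eq_part (Finset.mem_univ z) (Finset.mem_univ x)]]
  exact hb _

end Modularity

/-- If two dense graphs are close, up to kernels with few four-cycles, to the same step kernel
with almost the same type frequencies, then their modularities are close. -/
theorem modularity_le_add {U₁ U₂ P : Type} [Fintype U₁] [Fintype U₂] [DecidableEq U₁]
    [DecidableEq U₂] [Nonempty U₁] [Nonempty U₂] [Fintype P]
    {G₁ : SimpleGraph U₁} {G₂ : SimpleGraph U₂}
    {φ₁ : U₁ → P} {φ₂ : U₂ → P} {S : P → P → ℝ} (hS : ∀ p q, 0 ≤ S p q ∧ S p q ≤ 1)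
    {η τ r : ℝ} (hη : 0 ≤ η) (hr : 0 < r)
    (h₁ : fourCycleSum (fun x z => adj G₁ x z - S (φ₁ x) (φ₁ z)) ≤
      η ^ 4 * (Fintype.card U₁ : ℝ) ^ 4)
    (h₂ : fourCycleSum (fun x z => adj G₂ x z - S (φ₂ x) (φ₂ z)) ≤
      η ^ 4 * (Fintype.card U₂ : ℝ) ^ 4)
    (hτ : ∑ p, |freq φ₂ p - freq φ₁ p| ≤ τ) (hr₁ : r ≤ density (adj G₁))
    (hr₂ : r ≤ density (adj G₂)) :
    modularity G₂ ≤ modularity G₁ +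
      (1 / r + 1 / r ^ 2 + 2 / r ^ 2 + 2 / r ^ 4) * (2 * η + 2 * τ) +
      1 / (r ^ 2 * Fintype.card U₁) := by
  refine modularity_le (hr.trans_le hr₂) fun σ => ?_
  obtain ⟨y, hy, hle⟩ := exists_score_le (adj_mem G₁) (adj_mem G₂) hS hη hr h₁ h₂ hτ hr₁ hr₂
    (isFracColoring_ofColoring σ)
  obtain ⟨σ', hσ'⟩ := exists_coloring_score (adj_mem G₁) (adj_self G₁) hr hr₁ hy
  have := score_ofColoring_le_modularity (hr.trans_le hr₁) σ'
  linarith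

section Regularity

variable {U P : Type} [Fintype U]

/-- The average of a kernel over each pair of types. -/
noncomputable def blockAverage (A : U → U → ℝ) (φ : U → P) (p q : P) : ℝ :=
  (∑ x, ∑ z, if φ x = p ∧ φ z = q then A x z else 0) /
    ((∑ x, if φ x = p then 1 else 0) * ∑ z, if φ z = q then 1 else 0)

theorem blockAverage_mem {A : U → U → ℝ} (hA : ∀ x z, 0 ≤ A x z ∧ A x z ≤ 1) (φ : U → P)
    (p q : P) : 0 ≤ blockAverage A φ p q ∧ blockAverage A φ p q ≤ 1 := by
  have h0 : ∀ r : P, (0 : ℝ) ≤ ∑ x, if φ x = r then 1 else 0 := fun r =>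
    Finset.sum_nonneg fun x _ => by split_ifs <;> norm_num
  refine ⟨div_nonneg (Finset.sum_nonneg fun x _ => Finset.sum_nonneg fun z _ => ?_)
    (mul_nonneg (h0 p) (h0 q)), div_le_one_of_le₀ ?_ (mul_nonneg (h0 p) (h0 q))⟩
  · split_ifs
    exacts [(hA x z).1, le_rfl]
  · rw [Finset.sum_mul_sum]
    refine Finset.sum_le_sum fun x _ => Finset.sum_le_sum fun z _ => ?_
    by_cases hx : φ x = p <;> by_cases hz : φ z = q <;> simp [hx, hz, (hA x z).2]

theorem blockAverage_mul {A : U → U → ℝ} (hA : ∀ x z, 0 ≤ A x z ∧ A x z ≤ 1) (φ : U → P)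
    (p q : P) : blockAverage A φ p q *
      ((∑ x, if φ x = p then 1 else 0) * ∑ z, if φ z = q then 1 else 0) =
        ∑ x, ∑ z, if φ x = p ∧ φ z = q then A x z else 0 := by
  rw [blockAverage]
  by_cases h : ((∑ x, if φ x = p then 1 else 0) * ∑ z, if φ z = q then 1 else 0 : ℝ) = 0
  · rw [h, mul_zero]
    refine le_antisymm (Finset.sum_nonneg fun x _ => Finset.sum_nonneg fun z _ => ?_) ?_
    · split_ifs
      exacts [(hA x z).1, le_rfl]
    · refine le_trans ?_ h.le
      rw [Finset.sum_mul_sum]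
      refine Finset.sum_le_sum fun x _ => Finset.sum_le_sum fun z _ => ?_
      by_cases hx : φ x = p <;> by_cases hz : φ z = q <;> simp [hx, hz, (hA x z).2]
  · exact div_mul_cancel₀ _ h

theorem sum_mul_eq_sum_blockAverage_mul [Fintype P] {A : U → U → ℝ}
    (hA : ∀ x z, 0 ≤ A x z ∧ A x z ≤ 1) (φ : U → P) (h : P → P → ℝ) :
    ∑ x, ∑ z, A x z * h (φ x) (φ z) =
      ∑ x, ∑ z, blockAverage A φ (φ x) (φ z) * h (φ x) (φ z) := by
  have h1 := sum_step_eq φ (fun p q => blockAverage A φ p q * h p q) (fun _ => 1) (fun _ => 1)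
  simp only [mul_one] at h1
  rw [h1]
  have h2 : ∀ p q, blockAverage A φ p q * h p q *
      ((∑ x, if φ x = p then 1 else 0) * ∑ z, if φ z = q then 1 else 0) =
      ∑ x, ∑ z, if φ x = p ∧ φ z = q then A x z * h p q else 0 := fun p q => by
    rw [mul_right_comm, blockAverage_mul hA, Finset.sum_mul]
    refine Finset.sum_congr rfl fun x _ => ?_
    rw [Finset.sum_mul]
    refine Finset.sum_congr rfl fun z _ => ?_
    rw [ite_mul, zero_mul]
  simp only [h2]
  have h3 : ∀ x z, A x z * h (φ x) (φ z) =
      ∑ p, ∑ q, if φ x = p ∧ φ z = q then A x z * h p q else 0 := fun x z => by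
    simp [ite_and]
  simp only [h3]
  calc _ = ∑ x, ∑ p, ∑ z, ∑ q, if φ x = p ∧ φ z = q then A x z * h p q else 0 :=
        Finset.sum_congr rfl fun x _ => Finset.sum_comm
    _ = ∑ p, ∑ x, ∑ z, ∑ q, if φ x = p ∧ φ z = q then A x z * h p q else 0 := Finset.sum_comm
    _ = ∑ p, ∑ x, ∑ q, ∑ z, if φ x = p ∧ φ z = q then A x z * h p q else 0 :=
        Finset.sum_congr rfl fun p _ => Finset.sum_congr rfl fun x _ => Finset.sum_comm
    _ = _ := Finset.sum_congr rfl fun p _ => Finset.sum_comm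

/-- The squared norm of the block average of a kernel. -/
noncomputable def energy (A : U → U → ℝ) (φ : U → P) : ℝ :=
  ∑ x, ∑ z, blockAverage A φ (φ x) (φ z) ^ 2

theorem energy_le {A : U → U → ℝ} (hA : ∀ x z, 0 ≤ A x z ∧ A x z ≤ 1) (φ : U → P) :
    energy A φ ≤ (Fintype.card U : ℝ) ^ 2 := by
  refine (Finset.sum_le_sum fun x _ => Finset.sum_le_sum fun z _ =>
    pow_le_one₀ (blockAverage_mem hA φ _ _).1 (blockAverage_mem hA φ _ _).2).trans ?_
  simp [sq]

theorem energy_increment [Nonempty U] [Fintype P] {Q : Type} [Fintype Q] {A : U → U → ℝ}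
    (hA : ∀ x z, 0 ≤ A x z ∧ A x z ≤ 1) {φ : U → P} {ψ : U → Q} {π : Q → P}
    (hπ : ∀ x, π (ψ x) = φ x) {f g : Q → ℝ} (hf : ∀ q, |f q| ≤ 1) (hg : ∀ q, |g q| ≤ 1)
    {δ : ℝ} (hδ : 0 ≤ δ) (h : δ * (Fintype.card U : ℝ) ^ 2 ≤
      ∑ x, ∑ z, (A x z - blockAverage A φ (φ x) (φ z)) * (f (ψ x) * g (ψ z))) :
    energy A φ + δ ^ 2 * (Fintype.card U : ℝ) ^ 2 ≤ energy A ψ := by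
  have hn : (0 : ℝ) < Fintype.card U := by exact_mod_cast Fintype.card_pos
  set n : ℝ := (Fintype.card U : ℝ) with hn_def
  set T : U → U → ℝ := fun x z => blockAverage A φ (φ x) (φ z) with hT
  set T' : U → U → ℝ := fun x z => blockAverage A ψ (ψ x) (ψ z) with hT'
  have h1 : ∑ x, ∑ z, (A x z - T x z) * (f (ψ x) * g (ψ z)) =
      ∑ x, ∑ z, (T' x z - T x z) * (f (ψ x) * g (ψ z)) := by
    have := sum_mul_eq_sum_blockAverage_mul hA ψ (fun p q => f p * g q)
    simp only [sub_mul, Finset.sum_sub_distrib, hT']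
    rw [this]
  have h2 : ∑ x, ∑ z, T' x z * T x z = ∑ x, ∑ z, T x z ^ 2 := by
    have e1 := sum_mul_eq_sum_blockAverage_mul hA ψ (fun p q => blockAverage A φ (π p) (π q))
    have e2 := sum_mul_eq_sum_blockAverage_mul hA φ (blockAverage A φ)
    simp only [hπ] at e1
    simp only [hT, hT', sq]
    rw [← e1, e2]
  have h3 : ∑ x, ∑ z, (T' x z - T x z) ^ 2 = energy A ψ - energy A φ := by
    have : ∀ x z, (T' x z - T x z) ^ 2 = T' x z ^ 2 - 2 * (T' x z * T x z) + T x z ^ 2 :=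
      fun x z => by ring
    simp only [this, Finset.sum_add_distrib, Finset.sum_sub_distrib, ← Finset.mul_sum, h2]
    simp only [energy, hT, hT']
    ring
  have h4 : (∑ x, ∑ z, (T' x z - T x z) * (f (ψ x) * g (ψ z))) ^ 2 ≤
      (energy A ψ - energy A φ) * n ^ 2 := by
    rw [← h3, ← Fintype.sum_prod_type', ← Fintype.sum_prod_type']
    refine (Finset.sum_mul_sq_le_sq_mul_sq _ _ _).trans ?_
    refine mul_le_mul_of_nonneg_left ?_ (Finset.sum_nonneg fun _ _ => sq_nonneg _)
    have : ∀ q : U × U, (f (ψ q.1) * g (ψ q.2)) ^ 2 ≤ 1 := fun q => by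
      rw [sq_le_one_iff_abs_le_one, abs_mul]
      exact mul_le_one₀ (hf _) (abs_nonneg _) (hg _)
    refine (Finset.sum_le_sum fun q _ => this q).trans ?_
    simp [n, sq]
  rw [h1] at h
  have h5 : (δ * n ^ 2) ^ 2 ≤ (energy A ψ - energy A φ) * n ^ 2 :=
    (pow_le_pow_left₀ (by positivity) h 2).trans h4
  have h6 : δ ^ 2 * n ^ 2 ≤ energy A ψ - energy A φ := by
    refine le_of_mul_le_mul_right ?_ (by positivity : 0 < n ^ 2)
    calc _ = (δ * n ^ 2) ^ 2 := by ring
      _ ≤ _ := h5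
  linarith

theorem fourCycleSum_eq (E : U → U → ℝ) :
    fourCycleSum E = ∑ y, ∑ w, ∑ x, ∑ z, E x z * (E x w * E y w * E y z) := by
  rw [fourCycleSum, Finset.sum_comm]
  refine Finset.sum_congr rfl fun y _ => ?_
  rw [Finset.sum_comm]
  refine Finset.sum_congr rfl fun x _ => ?_
  rw [sq, Finset.sum_mul_sum, Finset.sum_comm]
  exact Finset.sum_congr rfl fun w _ => Finset.sum_congr rfl fun z _ => by ring

theorem abs_sub_le_one_of_mem {a b : ℝ} (ha : 0 ≤ a ∧ a ≤ 1) (hb : 0 ≤ b ∧ b ≤ 1) :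
    |a - b| ≤ 1 := by
  rw [abs_le]
  constructor <;> linarith

theorem exists_energy_increment [Nonempty U] [Fintype P] {G : SimpleGraph U} {φ : U → P} {δ : ℝ}
    (hδ : 0 ≤ δ) (h : δ * (Fintype.card U : ℝ) ^ 4 <
      fourCycleSum fun x z => adj G x z - blockAverage (adj G) φ (φ x) (φ z)) :
    ∃ ψ : U → P × Bool × Bool,
      energy (adj G) φ + δ ^ 2 * (Fintype.card U : ℝ) ^ 2 ≤ energy (adj G) ψ := by
  obtain ⟨S, hS⟩ : ∃ S, S = blockAverage (adj G) φ := ⟨_, rfl⟩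
  have hSm : ∀ p q, 0 ≤ S p q ∧ S p q ≤ 1 := hS ▸ blockAverage_mem (adj_mem G) φ
  obtain ⟨E, hE⟩ : ∃ E : U → U → ℝ, ∀ x z, E x z = adj G x z - S (φ x) (φ z) :=
    ⟨_, fun _ _ => rfl⟩
  simp only [← hS, ← hE] at h
  obtain ⟨y, w, hyw⟩ : ∃ y w, δ * (Fintype.card U : ℝ) ^ 2 ≤
      ∑ x, ∑ z, E x z * (E x w * E y w * E y z) := by
    by_contra! hcon
    rw [fourCycleSum_eq] at h
    refine absurd h (not_lt.2 ?_)
    refine (Finset.sum_le_sum fun y _ => Finset.sum_le_sum fun w _ => (hcon y w).le).trans_eq ?_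
    simp only [Finset.sum_const, Finset.card_univ, nsmul_eq_mul]
    ring
  obtain ⟨β, hβ, hadj⟩ : ∃ β : Bool → ℝ, (∀ b, 0 ≤ β b ∧ β b ≤ 1) ∧
      ∀ x z, β (decide (G.Adj x z)) = adj G x z :=
    ⟨fun b => if b then 1 else 0, fun b => by cases b <;> simp, fun x z => by simp [adj]⟩
  obtain ⟨ψ, hψ⟩ : ∃ ψ : U → P × Bool × Bool,
      ∀ x, ψ x = (φ x, decide (G.Adj x w), decide (G.Adj x y)) := ⟨_, fun _ => rfl⟩
  have hf : ∀ q : P × Bool × Bool, |(β q.2.1 - S q.1 (φ w)) * E y w| ≤ 1 := fun q => by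
    rw [abs_mul, hE]
    exact mul_le_one₀ (abs_sub_le_one_of_mem (hβ _) (hSm _ _)) (abs_nonneg _)
      (abs_sub_le_one_of_mem (adj_mem G _ _) (hSm _ _))
  have hg : ∀ q : P × Bool × Bool, |β q.2.2 - S (φ y) q.1| ≤ 1 := fun q =>
    abs_sub_le_one_of_mem (hβ _) (hSm _ _)
  refine ⟨ψ, energy_increment (adj_mem G) (π := Prod.fst) (fun x => by rw [hψ]) hf hg hδ ?_⟩
  refine hyw.trans_eq (Finset.sum_congr rfl fun x _ => Finset.sum_congr rfl fun z _ => ?_)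
  simp only [hψ, hadj, hE, adj_comm G z y, ← hS]

end Regularity

/-- A weak regularity lemma: every graph is, up to a kernel with few four-cycles, a step kernel
with boundedly many types. -/
theorem exists_step_kernel {δ : ℝ} (hδ : 0 < δ) :
    ∃ M : ℕ, ∀ (U : Type) [Fintype U] [Nonempty U] (G : SimpleGraph U),
      ∃ (P : Type) (_ : Fintype P) (φ : U → P) (S : P → P → ℝ), Fintype.card P ≤ M ∧
        (∀ p q, 0 ≤ S p q ∧ S p q ≤ 1) ∧
        fourCycleSum (fun x z => adj G x z - S (φ x) (φ z)) ≤ δ * (Fintype.card U : ℝ) ^ 4 := by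
  obtain ⟨j, hj⟩ := exists_nat_gt (1 / δ ^ 2)
  refine ⟨4 ^ j, fun U _ _ G => ?_⟩
  have hn : (0 : ℝ) < Fintype.card U := by exact_mod_cast Fintype.card_pos
  by_contra! hcon
  have key : ∀ i ≤ j, ∃ (P : Type) (_ : Fintype P) (φ : U → P), Fintype.card P ≤ 4 ^ i ∧
      i * (δ ^ 2 * (Fintype.card U : ℝ) ^ 2) ≤ energy (adj G) φ := by
    intro i
    induction i with
    | zero =>
      intro _
      refine ⟨Unit, inferInstance, fun _ => (), by simp, ?_⟩
      simp only [Nat.cast_zero, zero_mul]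
      exact Finset.sum_nonneg fun _ _ => Finset.sum_nonneg fun _ _ => sq_nonneg _
    | succ i ih =>
      intro hi
      obtain ⟨P, _, φ, hc, he⟩ := ih (by omega)
      obtain ⟨ψ, hψ⟩ := exists_energy_increment hδ.le (hcon P inferInstance φ
        (blockAverage (adj G) φ) (hc.trans (Nat.pow_le_pow_right (by norm_num) (by omega)))
        (blockAverage_mem (adj_mem G) φ))
      refine ⟨P × Bool × Bool, inferInstance, ψ, ?_, ?_⟩
      · simp only [Fintype.card_prod, Fintype.card_bool, pow_succ]
        omega
      · push_cast
        linarith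
  obtain ⟨P, _, φ, -, he⟩ := key j le_rfl
  have h1 := he.trans (energy_le (adj_mem G) φ)
  rw [div_lt_iff₀ (by positivity)] at hj
  have h2 : (0 : ℝ) < (Fintype.card U : ℝ) ^ 2 := by positivity
  nlinarith

section Sampling

variable {V : Type}

theorem sum_four_not_distinct_le (X : Finset V) :
    ∑ x ∈ X, ∑ y ∈ X, ∑ z ∈ X, ∑ w ∈ X,
      (if #({x, y, z, w} : Finset V) = 4 then 0 else 1 : ℝ) ≤ 6 * (#X : ℝ) ^ 3 := by
  have hle : ∀ x y z w : V, (if #({x, y, z, w} : Finset V) = 4 then 0 else 1 : ℝ) ≤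
      (if x = y then 1 else 0) + (if x = z then 1 else 0) + (if x = w then 1 else 0) +
      (if y = z then 1 else 0) + (if y = w then 1 else 0) + (if z = w then 1 else 0) := by
    intro x y z w
    by_cases h : x = y ∨ x = z ∨ x = w ∨ y = z ∨ y = w ∨ z = w
    · have h1 : (if #({x, y, z, w} : Finset V) = 4 then 0 else 1 : ℝ) ≤ 1 := by
        split_ifs <;> norm_num
      refine h1.trans ?_
      have h0 : ∀ p : Prop, (0 : ℝ) ≤ if p then 1 else 0 := fun p => by split_ifs <;> norm_num
      have := h0 (x = y)
      have := h0 (x = z)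
      have := h0 (x = w)
      have := h0 (y = z)
      have := h0 (y = w)
      have := h0 (z = w)
      rcases h with h | h | h | h | h | h <;> rw [if_pos h] at * <;> linarith
    · push Not at h
      obtain ⟨h1, h2, h3, h4, h5, h6⟩ := h
      have : #({x, y, z, w} : Finset V) = 4 := by
        simp [Finset.card_insert_of_notMem, h1, h2, h3, h4, h5, h6]
      simp [this, h1, h2, h3, h4, h5, h6]
  refine (Finset.sum_le_sum fun x _ => Finset.sum_le_sum fun y _ => Finset.sum_le_sum fun z _ =>
    Finset.sum_le_sum fun w _ => hle x y z w).trans_eq ?_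
  simp only [Finset.sum_add_distrib, Finset.sum_const, nsmul_eq_mul, ← Finset.mul_sum,
    Finset.sum_ite_eq, Finset.sum_ite_mem, Finset.inter_self]
  ring

theorem sum_four_eq [Fintype V] (X : Finset V) (h : V → V → V → V → ℝ) :
    ∑ x ∈ X, ∑ y ∈ X, ∑ z ∈ X, ∑ w ∈ X, h x y z w =
      ∑ q : V × V × V × V, if {q.1, q.2.1, q.2.2.1, q.2.2.2} ⊆ X then
        h q.1 q.2.1 q.2.2.1 q.2.2.2 else 0 := by
  simp only [Fintype.sum_prod_type, Finset.insert_subset_iff, Finset.singleton_subset_iff, ite_and,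
    Finset.sum_ite_irrel, Finset.sum_ite_mem, Finset.univ_inter, Finset.sum_const_zero]

theorem choose_mul_pow_le {n k : ℕ} (hk : 4 ≤ k) (hkn : k ≤ n) :
    ((n - 4).choose (k - 4)) * n ^ 4 ≤ n.choose k * k ^ 4 := by
  have h1 := Nat.choose_mul (n := n) hk
  have h2 : k.choose 4 * n ^ 4 ≤ n.choose 4 * k ^ 4 := by
    refine Nat.le_of_mul_le_mul_left ?_ (Nat.factorial_pos 4)
    rw [← mul_assoc, ← mul_assoc, ← Nat.descFactorial_eq_factorial_mul_choose,
      ← Nat.descFactorial_eq_factorial_mul_choose]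
    simp only [Nat.descFactorial_succ, Nat.descFactorial_zero]
    have hi : ∀ i, (k - i) * n ≤ (n - i) * k := fun i => by
      rw [Nat.sub_mul, Nat.sub_mul, mul_comm n k]
      exact Nat.sub_le_sub_left (Nat.mul_le_mul_left i hkn) _
    calc _ = ((k - 3) * n) * (((k - 2) * n) * (((k - 1) * n) * ((k - 0) * n))) := by ring
      _ ≤ ((n - 3) * k) * (((n - 2) * k) * (((n - 1) * k) * ((n - 0) * k))) := by
        exact Nat.mul_le_mul (hi 3) (Nat.mul_le_mul (hi 2) (Nat.mul_le_mul (hi 1) (hi 0)))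
      _ = _ := by ring
  refine Nat.le_of_mul_le_mul_left ?_ (Nat.choose_pos (hk.trans hkn))
  calc n.choose 4 * ((n - 4).choose (k - 4) * n ^ 4)
      = n.choose k * (k.choose 4 * n ^ 4) := by rw [← mul_assoc, ← h1, mul_assoc]
    _ ≤ n.choose k * (n.choose 4 * k ^ 4) := by gcongr
    _ = _ := by ring

theorem choose_mul_pow_three_le {n k : ℕ} (hk : 4 ≤ k) (hkn : k ≤ n) :
    ((n - 4).choose (k - 4)) * n ^ 3 ≤ n.choose k * k ^ 3 := by
  refine Nat.le_of_mul_le_mul_right ?_ (show 0 < n by omega)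
  calc _ = ((n - 4).choose (k - 4)) * n ^ 4 := by ring
    _ ≤ n.choose k * k ^ 4 := choose_mul_pow_le hk hkn
    _ = n.choose k * k ^ 3 * k := by ring
    _ ≤ _ := by gcongr

theorem abs_sum_four_not_distinct_le (X : Finset V) {h : V → V → V → V → ℝ} {B : ℝ}
    (hB : ∀ x y z w, |h x y z w| ≤ B) :
    |∑ x ∈ X, ∑ y ∈ X, ∑ z ∈ X, ∑ w ∈ X,
      (if #({x, y, z, w} : Finset V) = 4 then 0 else h x y z w)| ≤ 6 * B * (#X : ℝ) ^ 3 := by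
  rcases X.eq_empty_or_nonempty with rfl | ⟨v, -⟩
  · simp
  have hB0 : 0 ≤ B := (abs_nonneg _).trans (hB v v v v)
  calc _ ≤ ∑ x ∈ X, ∑ y ∈ X, ∑ z ∈ X, ∑ w ∈ X,
      B * (if #({x, y, z, w} : Finset V) = 4 then 0 else 1) := by
        refine (Finset.abs_sum_le_sum_abs _ _).trans (Finset.sum_le_sum fun x _ => ?_)
        refine (Finset.abs_sum_le_sum_abs _ _).trans (Finset.sum_le_sum fun y _ => ?_)
        refine (Finset.abs_sum_le_sum_abs _ _).trans (Finset.sum_le_sum fun z _ => ?_)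
        refine (Finset.abs_sum_le_sum_abs _ _).trans (Finset.sum_le_sum fun w _ => ?_)
        split_ifs
        · simp
        · simpa using hB x y z w
    _ ≤ B * (6 * (#X : ℝ) ^ 3) := by
        simp only [← Finset.mul_sum]
        exact mul_le_mul_of_nonneg_left (sum_four_not_distinct_le X) hB0
    _ = _ := by ring

/-- The average of a bounded four-variable sum over a random `k`-element set is close to the
rescaled full sum. -/
theorem sum_powersetCard_sum_four_le [Fintype V] {h : V → V → V → V → ℝ} {B H : ℝ} {k : ℕ}
    (hB : ∀ x y z w, |h x y z w| ≤ B) (hB0 : 0 ≤ B) (hH0 : 0 ≤ H)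
    (hH : ∑ x, ∑ y, ∑ z, ∑ w, h x y z w ≤ H * (Fintype.card V : ℝ) ^ 4)
    (hk : 4 ≤ k) (hkn : k ≤ Fintype.card V) :
    ∑ X ∈ powersetCard k (univ : Finset V), ∑ x ∈ X, ∑ y ∈ X, ∑ z ∈ X, ∑ w ∈ X, h x y z w ≤
      (Fintype.card V).choose k * (H * (k : ℝ) ^ 4 + 12 * B * (k : ℝ) ^ 3) := by
  obtain ⟨n, hn⟩ : ∃ n, n = Fintype.card V := ⟨_, rfl⟩
  rw [← hn] at hkn hH ⊢
  obtain ⟨f, hf⟩ : ∃ f : V → V → V → V → ℝ, ∀ x y z w, f x y z w =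
      if #({x, y, z, w} : Finset V) = 4 then h x y z w else 0 := ⟨_, fun _ _ _ _ => rfl⟩
  obtain ⟨g, hg⟩ : ∃ g : V → V → V → V → ℝ, ∀ x y z w, g x y z w =
      if #({x, y, z, w} : Finset V) = 4 then 0 else h x y z w := ⟨_, fun _ _ _ _ => rfl⟩
  have hfg : ∀ x y z w, h x y z w = f x y z w + g x y z w := fun x y z w => by
    rw [hf, hg]
    split_ifs <;> simp
  have hgX : ∀ X : Finset V, |∑ x ∈ X, ∑ y ∈ X, ∑ z ∈ X, ∑ w ∈ X, g x y z w| ≤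
      6 * B * (#X : ℝ) ^ 3 := fun X => by
    simp only [hg]
    exact abs_sum_four_not_distinct_le X hB
  have hfc : ∑ X ∈ powersetCard k (univ : Finset V),
      ∑ x ∈ X, ∑ y ∈ X, ∑ z ∈ X, ∑ w ∈ X, f x y z w =
      (n - 4).choose (k - 4) * ∑ x, ∑ y, ∑ z, ∑ w, f x y z w := by
    have hq : ∀ q : V × V × V × V, (∑ X ∈ powersetCard k (univ : Finset V),
        if {q.1, q.2.1, q.2.2.1, q.2.2.2} ⊆ X then f q.1 q.2.1 q.2.2.1 q.2.2.2 else 0) =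
        (n - 4).choose (k - 4) * f q.1 q.2.1 q.2.2.1 q.2.2.2 := fun q => by
      rw [← Finset.sum_filter, Finset.sum_const, nsmul_eq_mul]
      by_cases h4 : #({q.1, q.2.1, q.2.2.1, q.2.2.2} : Finset V) = 4
      · rw [Finset.card_filter_powersetCard_subset _ _ _ (Finset.subset_univ _) (h4 ▸ hk), h4,
          Finset.card_univ, hn]
      · rw [hf, if_neg h4, mul_zero, mul_zero]
    simp only [sum_four_eq]
    rw [Finset.sum_comm, Finset.mul_sum]
    simp only [hq, Finset.subset_univ, if_true]
  simp only [hfg, Finset.sum_add_distrib] at hH ⊢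
  rw [hfc]
  have hc4 : ((n - 4).choose (k - 4) : ℝ) * n ^ 4 ≤ n.choose k * k ^ 4 := by
    exact_mod_cast choose_mul_pow_le hk hkn
  have hc3 : ((n - 4).choose (k - 4) : ℝ) * n ^ 3 ≤ n.choose k * k ^ 3 := by
    exact_mod_cast choose_mul_pow_three_le hk hkn
  have h1 : ∑ X ∈ powersetCard k (univ : Finset V),
      ∑ x ∈ X, ∑ y ∈ X, ∑ z ∈ X, ∑ w ∈ X, g x y z w ≤ n.choose k * (6 * B * (k : ℝ) ^ 3) := by
    refine (Finset.sum_le_card_nsmul _ _ (6 * B * (k : ℝ) ^ 3) fun X hX => ?_).trans_eq ?_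
    · rw [← (Finset.mem_powersetCard.1 hX).2]
      exact (le_abs_self _).trans (hgX X)
    · rw [Finset.card_powersetCard, Finset.card_univ, nsmul_eq_mul, hn]
  have h2 : ∑ x, ∑ y, ∑ z, ∑ w, f x y z w ≤ H * (n : ℝ) ^ 4 + 6 * B * (n : ℝ) ^ 3 := by
    have := (abs_le.1 (hgX univ)).1
    rw [Finset.card_univ, ← hn] at this
    linarith
  have h3 := mul_le_mul_of_nonneg_left h2 (Nat.cast_nonneg (α := ℝ) ((n - 4).choose (k - 4)))
  have h4 := mul_le_mul_of_nonneg_left hc4 hH0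
  have h5 := mul_le_mul_of_nonneg_left hc3 (mul_nonneg (by norm_num : (0 : ℝ) ≤ 6) hB0)
  linarith

end Sampling

/-- A version of `modularity_le_add` that needs the density of one graph only. -/
theorem abs_modularity_sub_le {U₁ U₂ P : Type} [Fintype U₁] [Fintype U₂] [DecidableEq U₁]
    [DecidableEq U₂] [Nonempty U₁] [Nonempty U₂] [Fintype P]
    {G₁ : SimpleGraph U₁} {G₂ : SimpleGraph U₂}
    {φ₁ : U₁ → P} {φ₂ : U₂ → P} {S : P → P → ℝ} (hS : ∀ p q, 0 ≤ S p q ∧ S p q ≤ 1)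
    {η r : ℝ} (hη : 0 ≤ η) (hr : 0 < r)
    (h₁ : fourCycleSum (fun x z => adj G₁ x z - S (φ₁ x) (φ₁ z)) ≤
      η ^ 4 * (Fintype.card U₁ : ℝ) ^ 4)
    (h₂ : fourCycleSum (fun x z => adj G₂ x z - S (φ₂ x) (φ₂ z)) ≤
      η ^ 4 * (Fintype.card U₂ : ℝ) ^ 4)
    (hφ : ∑ p, |freq φ₂ p - freq φ₁ p| ≤ η) (hr₁ : r + 4 * η ≤ density (adj G₁))
    {k : ℕ} (hk : 0 < k) (hk₁ : k ≤ Fintype.card U₁) (hk₂ : k ≤ Fintype.card U₂) :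
    |modularity G₁ - modularity G₂| ≤
      (1 / r + 1 / r ^ 2 + 2 / r ^ 2 + 2 / r ^ 4) * (4 * η) + 1 / (r ^ 2 * k) := by
  have d₁ := abs_le.1 (abs_density_sub_le hη h₁)
  have d₂ := abs_le.1 (abs_density_sub_le hη h₂)
  have d₃ := abs_le.1 (abs_sum_sub_le (s := S)
    (sum_abs_mul_sub_le (freq_nonneg φ₂) (sum_freq φ₂) (freq_nonneg φ₁) (sum_freq φ₁) hφ)
    fun p q => abs_le.2 ⟨by linarith [(hS p q).1], (hS p q).2⟩)
  rw [← density_step, ← density_step] at d₃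
  have hr₂ : r ≤ density (adj G₂) := by linarith [d₁.1, d₁.2, d₂.1, d₂.2, d₃.1, d₃.2]
  have hr₁' : r ≤ density (adj G₁) := by linarith
  have hφ' : ∑ p, |freq φ₁ p - freq φ₂ p| ≤ η := by simpa only [abs_sub_comm] using hφ
  have e₁ := modularity_le_add hS hη hr h₁ h₂ hφ hr₁' hr₂
  have e₂ := modularity_le_add hS hη hr h₂ h₁ hφ' hr₂ hr₁'
  have hle : ∀ c : ℕ, k ≤ c → 1 / (r ^ 2 * (c : ℝ)) ≤ 1 / (r ^ 2 * k) := fun c hc => by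
    have : (0 : ℝ) < k := by exact_mod_cast hk
    gcongr
  have f₁ := hle _ hk₁
  have f₂ := hle _ hk₂
  rw [show 2 * η + 2 * η = 4 * η by ring] at e₁ e₂
  rw [abs_le]
  constructor <;> linarith

section Discrepancy

variable {V P : Type} [Fintype P]

theorem sum_coe_set (X : Finset V) [Fintype (X : Set V)] (f : V → ℝ) :
    ∑ x : (X : Set V), f x = ∑ x ∈ X, f x :=
  (Finset.sum_subtype X (fun x => by simp) f).symm

variable [Fintype V]

/-- A four-variable function whose sum over a set `X` measures both the number of four-cycles of
the kernel on `X` and the deviation of the type frequencies on `X`. -/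
noncomputable def discrepancy (E : V → V → ℝ) (φ : V → P) (x y z w : V) : ℝ :=
  E x z * E y z * (E x w * E y w) + Fintype.card P *
    ∑ p, ((if φ x = p then 1 else 0) - freq φ p) * ((if φ y = p then 1 else 0) - freq φ p)

theorem sum_discrepancy_eq (E : V → V → ℝ) (φ : V → P) (X : Finset V) :
    ∑ x ∈ X, ∑ y ∈ X, ∑ z ∈ X, ∑ w ∈ X, discrepancy E φ x y z w =
      ∑ x ∈ X, ∑ y ∈ X, (∑ z ∈ X, E x z * E y z) ^ 2 + (#X : ℝ) ^ 2 * (Fintype.card P *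
        ∑ p, (∑ x ∈ X, ((if φ x = p then 1 else 0) - freq φ p)) ^ 2) := by
  simp only [discrepancy, Finset.sum_add_distrib, Finset.sum_const, nsmul_eq_mul,
    ← Finset.mul_sum, sq, Finset.sum_mul_sum]
  have : ∑ p, ∑ x ∈ X, ∑ y ∈ X,
      ((if φ x = p then 1 else 0) - freq φ p) * ((if φ y = p then 1 else 0) - freq φ p) =
      ∑ x ∈ X, ∑ y ∈ X, ∑ p,
        ((if φ x = p then 1 else 0) - freq φ p) * ((if φ y = p then 1 else 0) - freq φ p) := by
    rw [Finset.sum_comm]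
    exact Finset.sum_congr rfl fun x _ => Finset.sum_comm
  simp only [← Finset.mul_sum] at this
  rw [this]
  ring

theorem freq_le_one [Nonempty V] (φ : V → P) (p : P) : freq φ p ≤ 1 := by
  rw [← sum_freq φ]
  exact Finset.single_le_sum (fun q _ => freq_nonneg φ q) (Finset.mem_univ p)

theorem abs_discrepancy_le [Nonempty V] {E : V → V → ℝ} (hE : ∀ x z, |E x z| ≤ 1) (φ : V → P)
    (x y z w : V) : |discrepancy E φ x y z w| ≤ 1 + (Fintype.card P : ℝ) ^ 2 := by
  have hp : ∀ x p, |(if φ x = p then 1 else 0) - freq φ p| ≤ 1 := fun x p =>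
    abs_sub_le_one_of_mem (by split_ifs <;> norm_num) ⟨freq_nonneg φ p, freq_le_one φ p⟩
  rw [discrepancy]
  refine (abs_add_le _ _).trans (add_le_add ?_ ?_)
  · simp only [abs_mul]
    exact mul_le_one₀ (mul_le_one₀ (hE _ _) (abs_nonneg _) (hE _ _)) (by positivity)
      (mul_le_one₀ (hE _ _) (abs_nonneg _) (hE _ _))
  · rw [abs_mul, Nat.abs_cast, sq]
    refine mul_le_mul_of_nonneg_left ((Finset.abs_sum_le_sum_abs _ _).trans ?_)
      (Nat.cast_nonneg _)
    refine (Finset.sum_le_card_nsmul _ _ 1 fun p _ => ?_).trans_eq (by simp)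
    rw [abs_mul]
    exact mul_le_one₀ (hp _ _) (abs_nonneg _) (hp _ _)

theorem sum_univ_discrepancy [Nonempty V] (E : V → V → ℝ) (φ : V → P) :
    ∑ x, ∑ y, ∑ z, ∑ w, discrepancy E φ x y z w = fourCycleSum E := by
  have h0 : ∀ p, ∑ x : V, ((if φ x = p then 1 else 0) - freq φ p) = 0 := fun p => by
    have : (Fintype.card V : ℝ) ≠ 0 := by exact_mod_cast Fintype.card_ne_zero
    rw [Finset.sum_sub_distrib, Finset.sum_const, Finset.card_univ, nsmul_eq_mul, freq,
      mul_div_cancel₀ _ this, sub_self]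
  rw [sum_discrepancy_eq]
  simp [h0, fourCycleSum]

theorem fourCycleSum_restrict_le {E : V → V → ℝ} {φ : V → P} {X : Finset V}
    [Fintype (X : Set V)] {c : ℝ}
    (h : ∑ x ∈ X, ∑ y ∈ X, ∑ z ∈ X, ∑ w ∈ X, discrepancy E φ x y z w ≤ c) :
    fourCycleSum (fun x z : (X : Set V) => E x z) ≤ c := by
  rw [sum_discrepancy_eq] at h
  have h1 : 0 ≤ (#X : ℝ) ^ 2 * (Fintype.card P *
      ∑ p, (∑ x ∈ X, ((if φ x = p then 1 else 0) - freq φ p)) ^ 2) := by positivity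
  have h2 : fourCycleSum (fun x z : (X : Set V) => E x z) =
      ∑ x ∈ X, ∑ y ∈ X, (∑ z ∈ X, E x z * E y z) ^ 2 := by
    simp only [fourCycleSum, ← sum_coe_set X]
  linarith

theorem sum_abs_freq_restrict_sub_le {E : V → V → ℝ} {φ : V → P} {X : Finset V}
    [Fintype (X : Set V)] (hX : X.Nonempty) {η : ℝ} (hη : 0 ≤ η)
    (h : ∑ x ∈ X, ∑ y ∈ X, ∑ z ∈ X, ∑ w ∈ X, discrepancy E φ x y z w ≤ η ^ 2 * (#X : ℝ) ^ 4) :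
    ∑ p, |freq (fun x : (X : Set V) => φ x) p - freq φ p| ≤ η := by
  have hc : (0 : ℝ) < #X := by exact_mod_cast hX.card_pos
  rw [sum_discrepancy_eq] at h
  have h1 : 0 ≤ ∑ x ∈ X, ∑ y ∈ X, (∑ z ∈ X, E x z * E y z) ^ 2 := by positivity
  have h2 : ∀ p, ∑ x ∈ X, ((if φ x = p then 1 else 0) - freq φ p) =
      #X * (freq (fun x : (X : Set V) => φ x) p - freq φ p) := fun p => by
    have hcard : (Fintype.card (X : Set V) : ℝ) = #X := by
      simp
    rw [freq.eq_1 (fun x : (X : Set V) => φ x), hcard,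
      sum_coe_set X fun x => if φ x = p then 1 else 0, mul_sub, mul_div_cancel₀ _ hc.ne']
    simp
  simp only [h2, mul_pow, ← Finset.mul_sum] at h
  have h3 : (∑ p, |freq (fun x : (X : Set V) => φ x) p - freq φ p|) ^ 2 ≤ Fintype.card P *
      ∑ p, (freq (fun x : (X : Set V) => φ x) p - freq φ p) ^ 2 := by
    simpa using sq_sum_le_card_mul_sum_sq (s := univ)
      (f := fun p => |freq (fun x : (X : Set V) => φ x) p - freq φ p|)
  have h4 : (∑ p, |freq (fun x : (X : Set V) => φ x) p - freq φ p|) ^ 2 ≤ η ^ 2 := by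
    refine h3.trans (le_of_mul_le_mul_right ?_ (by positivity : (0 : ℝ) < (#X : ℝ) ^ 4))
    linarith
  exact le_of_sq_le_sq h4 hη

end Discrepancy

theorem card_filter_lt_mul_le {α : Type} (s : Finset α) (F : α → ℝ) (hF : ∀ a ∈ s, 0 ≤ F a)
    (t : ℝ) : (#(s.filter fun a => t < F a) : ℝ) * t ≤ ∑ a ∈ s, F a := by
  rw [← nsmul_eq_mul]
  refine (Finset.card_nsmul_le_sum _ F t fun a ha => (Finset.mem_filter.1 ha).2.le).trans ?_
  exact Finset.sum_le_sum_of_subset_of_nonneg (Finset.filter_subset _ _) fun a ha _ => hF a ha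

theorem sum_discrepancy_nonneg {V P : Type} [Fintype V] [Fintype P] (E : V → V → ℝ) (φ : V → P)
    (X : Finset V) : 0 ≤ ∑ x ∈ X, ∑ y ∈ X, ∑ z ∈ X, ∑ w ∈ X, discrepancy E φ x y z w := by
  rw [sum_discrepancy_eq]
  positivity

/-- Modularity is estimable on graphs of density at least ρ (0 < ρ < 1): for every
ε > 0 there is a positive integer k such that for every finite graph G with at least
k vertices and e(G) ≥ ρ·v(G)²/2, a uniformly random k-element subset X of V(G)
satisfies P(|q*(G) − q*(G[X])| > ε) < ε. -/
theorem statement14 (ρ : ℝ) (hρ0 : 0 < ρ) (hρ1 : ρ < 1) :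
    ∀ ε : ℝ, 0 < ε →
      ∃ k : ℕ, 0 < k ∧
        ∀ (V : Type) [Fintype V] [DecidableEq V] (G : SimpleGraph V),
          k ≤ Fintype.card V →
          ρ * (Fintype.card V : ℝ) ^ 2 / 2 ≤ (edgeCount G : ℝ) →
          ((((univ : Finset V).powersetCard k).filter (fun X =>
              ε < |modularity G - modularity (G.induce (X : Set V))|)).card : ℝ) /
            ((((univ : Finset V).powersetCard k).card : ℕ) : ℝ) < ε := by
  intro ε hε
  obtain ⟨r, hr⟩ : ∃ r, r = ρ / 2 := ⟨_, rfl⟩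
  have hr0 : 0 < r := by linarith
  obtain ⟨K, hK⟩ : ∃ K, K = 1 / r + 1 / r ^ 2 + 2 / r ^ 2 + 2 / r ^ 4 := ⟨_, rfl⟩
  have hK0 : 0 < K := by rw [hK]; positivity
  obtain ⟨η, hη0, hη1, hηr, hηK⟩ : ∃ η : ℝ, 0 < η ∧ η ≤ 1 ∧ 4 * η ≤ r ∧ K * (4 * η) ≤ ε / 2 := by
    refine ⟨min 1 (min (r / 4) (ε / (8 * K))), by positivity, min_le_left _ _, ?_, ?_⟩
    · have := (min_le_right 1 (min (r / 4) (ε / (8 * K)))).trans (min_le_left _ _)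
      linarith
    · have := (min_le_right 1 (min (r / 4) (ε / (8 * K)))).trans (min_le_right _ _)
      rw [le_div_iff₀ (by positivity)] at this
      linarith
  obtain ⟨M, hM⟩ := exists_step_kernel (δ := η ^ 4 * min 1 (ε / 4)) (by positivity)
  obtain ⟨k, hk⟩ := exists_nat_ge
    (max 4 (max (2 / (ε * r ^ 2)) (48 * (1 + (M : ℝ) ^ 2) / (η ^ 4 * ε))))
  have hk4 : 4 ≤ k := by exact_mod_cast (le_max_left _ _).trans hk
  have hkr : 2 / (ε * r ^ 2) ≤ k :=
    ((le_max_left _ _).trans (le_max_right _ _)).trans hk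
  have hkM : 48 * (1 + (M : ℝ) ^ 2) / (η ^ 4 * ε) ≤ k :=
    ((le_max_right _ _).trans (le_max_right _ _)).trans hk
  have hk0 : (0 : ℝ) < k := by exact_mod_cast (by omega : 0 < k)
  rw [div_le_iff₀ (by positivity)] at hkr hkM
  refine ⟨k, by omega, fun V _ _ G hkV hG => ?_⟩
  have : Nonempty V := Fintype.card_pos_iff.1 (by omega)
  have hn : (0 : ℝ) < Fintype.card V := by exact_mod_cast Fintype.card_pos
  obtain ⟨P, _, φ, S, hP, hS, hE⟩ := hM V G
  obtain ⟨E, hEdef⟩ : ∃ E : V → V → ℝ, E = fun x z => adj G x z - S (φ x) (φ z) := ⟨_, rfl⟩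
  have hE1 : ∀ x z, |E x z| ≤ 1 := fun x z => by
    rw [hEdef]
    exact abs_sub_le_one_of_mem (adj_mem G x z) (hS _ _)
  have hEV : fourCycleSum (fun x z => adj G x z - S (φ x) (φ z)) ≤
      η ^ 4 * (Fintype.card V : ℝ) ^ 4 := by
    refine hE.trans (mul_le_mul_of_nonneg_right ?_ (by positivity))
    exact mul_le_of_le_one_right (by positivity) (min_le_left _ _)
  have hd : r + 4 * η ≤ density (adj G) := by
    rw [density, ← two_mul_edgeCount, le_div_iff₀ (by positivity)]
    nlinarith [pow_pos hn 2]
  have hgood : ∀ X ∈ powersetCard k (univ : Finset V), ∀ _ : Fintype (X : Set V),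
      ε < |modularity G - modularity (G.induce (X : Set V))| →
      η ^ 4 * (k : ℝ) ^ 4 < ∑ x ∈ X, ∑ y ∈ X, ∑ z ∈ X, ∑ w ∈ X, discrepancy E φ x y z w := by
    intro X hX _ hlt
    by_contra! hcon
    refine absurd hlt (not_lt.2 ?_)
    have hXk : #X = k := (Finset.mem_powersetCard.1 hX).2
    have hXne : X.Nonempty := Finset.card_pos.1 (by omega)
    have : Nonempty (X : Set V) := hXne.to_subtype
    have hcard : Fintype.card (X : Set V) = k := by simpa using hXk
    have h2 : fourCycleSum (fun x z : (X : Set V) =>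
        adj (G.induce (X : Set V)) x z - S (φ x) (φ z)) ≤
        η ^ 4 * (Fintype.card (X : Set V) : ℝ) ^ 4 := by
      rw [hcard]
      have := fourCycleSum_restrict_le hcon
      simpa only [hEdef, adj, SimpleGraph.comap_adj, Function.Embedding.subtype_apply] using this
    have hτ : ∑ p, |freq (fun x : (X : Set V) => φ x) p - freq φ p| ≤ η := by
      refine sum_abs_freq_restrict_sub_le hXne hη0.le (hcon.trans ?_)
      rw [hXk]
      exact mul_le_mul_of_nonneg_right (pow_le_pow_of_le_one hη0.le hη1 (by norm_num))
        (by positivity)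
    refine (abs_modularity_sub_le hS hη0.le hr0 hEV h2 hτ hd (by omega : 0 < k) hkV
      hcard.ge).trans ?_
    rw [← hK]
    have : 1 / (r ^ 2 * k) ≤ ε / 2 := by
      rw [div_le_iff₀ (by positivity)]
      linarith
    linarith
  have hsum := sum_powersetCard_sum_four_le (abs_discrepancy_le hE1 φ)
    (by positivity) (by positivity : 0 ≤ η ^ 4 * min 1 (ε / 4))
    (by rwa [sum_univ_discrepancy, hEdef]) hk4 hkV
  have hmarkov := (card_filter_lt_mul_le (powersetCard k (univ : Finset V)) _
    (fun X _ => sum_discrepancy_nonneg E φ X) (η ^ 4 * (k : ℝ) ^ 4)).trans hsum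
  rw [Finset.card_powersetCard, Finset.card_univ]
  have hC : (0 : ℝ) < (Fintype.card V).choose k := by exact_mod_cast Nat.choose_pos hkV
  refine (div_le_iff₀ hC).2 ?_ |>.trans_lt (half_lt_self hε)
  refine le_trans (b := ((#((powersetCard k (univ : Finset V)).filter fun X => η ^ 4 * (k : ℝ) ^ 4 <
      ∑ x ∈ X, ∑ y ∈ X, ∑ z ∈ X, ∑ w ∈ X, discrepancy E φ x y z w) : ℕ) : ℝ)) ?_ ?_
  · refine Nat.cast_le.2 ((Finset.card_le_card fun Y hY => ?_).trans
      (Finset.card_image_le (f := fun X : Finset V => (X : Set V))))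
    obtain ⟨hY, hlt⟩ := Finset.mem_filter.1 hY
    obtain ⟨X, hX, hXY⟩ := Finset.mem_sup.1 hY
    obtain rfl := Finset.mem_singleton.1 hXY
    exact Finset.mem_image.2 ⟨X, Finset.mem_filter.2 ⟨hX, hgood X hX _ hlt⟩, rfl⟩
  · refine le_of_mul_le_mul_right (hmarkov.trans ?_) (by positivity : 0 < η ^ 4 * (k : ℝ) ^ 4)
    rw [mul_comm (ε / 2), mul_assoc _ (ε / 2)]
    refine mul_le_mul_of_nonneg_left ?_ hC.le
    have h1 : η ^ 4 * min 1 (ε / 4) * (k : ℝ) ^ 4 ≤ η ^ 4 * (ε / 4) * (k : ℝ) ^ 4 := by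
      gcongr
      exact min_le_right _ _
    have h2 : 12 * (1 + (Fintype.card P : ℝ) ^ 2) ≤ k * (η ^ 4 * ε) / 4 := by
      have : (Fintype.card P : ℝ) ^ 2 ≤ (M : ℝ) ^ 2 := by gcongr
      linarith
    have h3 := mul_le_mul_of_nonneg_right h2 (by positivity : 0 ≤ (k : ℝ) ^ 3)
    calc _ ≤ η ^ 4 * (ε / 4) * (k : ℝ) ^ 4 + k * (η ^ 4 * ε) / 4 * (k : ℝ) ^ 3 := add_le_add h1 h3
      _ = _ := by ring
end

section
/- Let 0 < c < c′. Then for every ε > 0 there exists n₀ such that for all n ≥ n₀, E[q*(G_{n, c′/n})] − E[q*(G_{n, c/n})] < ε, where G_{n,p} is the binomial random graph on n vertices with edge probability p. Consequently, limsup_{n→∞} ( E[q*(G_{n, c′/n})] − E[q*(G_{n, c/n})] ) ≤ 0. -/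
open Finset
open scoped Classical

/-- The expected modularity E[q*(G_{n,p})] of the binomial random graph G_{n,p}
on vertex set Fin n, in which each possible edge is present independently with
probability p. -/
noncomputable def expModER (n : ℕ) (p : ℝ) : ℝ :=
  ∑ F ∈ (⊤ : SimpleGraph (Fin n)).edgeFinset.powerset,
    p ^ F.card * (1 - p) ^ ((⊤ : SimpleGraph (Fin n)).edgeFinset.card - F.card) *
      modularity (SimpleGraph.fromEdgeSet (F : Set (Sym2 (Fin n))))

/-- The proportion of `k`-subsets of `F` containing a given element is `k / #F`. -/
theorem card_filter_mem_powersetCard {α : Type*} [DecidableEq α] {F : Finset α} {k : ℕ}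
    (hk : 1 ≤ k) (hkF : k ≤ #F) {e : α} (he : e ∈ F) :
    (#{S ∈ F.powersetCard k | e ∈ S} : ℝ) = (#F).choose k * (k / #F) := by
  have h := card_filter_powersetCard_subset {e} F k (by simpa using he) (by simpa using hk)
  simp only [singleton_subset_iff, card_singleton] at h
  rw [h]
  obtain ⟨K, rfl⟩ : ∃ K, k = K + 1 := ⟨k - 1, by omega⟩
  obtain ⟨M, hM⟩ : ∃ M, #F = M + 1 := ⟨#F - 1, by omega⟩
  rw [hM]
  have := Nat.add_one_mul_choose_eq M K
  have h2 : ((M + 1 : ℕ) : ℝ) * (M.choose K : ℝ) =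
      ((M + 1).choose (K + 1) : ℝ) * ((K + 1 : ℕ) : ℝ) := by exact_mod_cast this
  have h3 : ((M + 1 : ℕ) : ℝ) ≠ 0 := by positivity
  simp only [Nat.add_sub_cancel]
  rw [← mul_div_assoc, ← h2]
  field_simp

/-- The proportion of `k`-subsets of `F` containing two given distinct elements is at most
`(k / #F) ^ 2`. -/
theorem card_filter_mem_mem_powersetCard_le {α : Type*} [DecidableEq α] {F : Finset α} {k : ℕ}
    (hkF : k ≤ #F) {e f : α} (he : e ∈ F) (hf : f ∈ F) (hef : e ≠ f) :
    (#{S ∈ F.powersetCard k | e ∈ S ∧ f ∈ S} : ℝ) ≤ (#F).choose k * (k / #F) ^ 2 := by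
  have hset : ∀ S : Finset α, ({e, f} ⊆ S) = (e ∈ S ∧ f ∈ S) := by
    intro S; simp [insert_subset_iff]
  rcases lt_or_ge k 2 with hk | hk
  · have h0 : {S ∈ F.powersetCard k | e ∈ S ∧ f ∈ S} = ∅ := by
      refine filter_eq_empty_iff.2 fun S hS h => ?_
      rw [← hset] at h
      have h1 := card_le_card h
      rw [card_pair hef, (mem_powersetCard.1 hS).2] at h1
      omega
    rw [h0]
    simp only [card_empty, Nat.cast_zero]
    positivity
  · have h := card_filter_powersetCard_subset {e, f} F k
      (by simp [insert_subset_iff, he, hf]) (by rwa [card_pair hef])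
    simp only [hset, card_pair hef] at h
    rw [h]
    obtain ⟨K, rfl⟩ : ∃ K, k = K + 2 := ⟨k - 2, by omega⟩
    obtain ⟨M, hM⟩ : ∃ M, #F = M + 2 := ⟨#F - 2, by omega⟩
    rw [hM] at hkF ⊢
    simp only [Nat.add_sub_cancel]
    have h1 : ((M : ℝ) + 2) * ((M + 1).choose (K + 1) : ℝ) =
        ((M + 2).choose (K + 2) : ℝ) * ((K : ℝ) + 2) := by
      exact_mod_cast Nat.add_one_mul_choose_eq (M + 1) (K + 1)
    have h2 : ((M : ℝ) + 1) * (M.choose K : ℝ) =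
        ((M + 1).choose (K + 1) : ℝ) * ((K : ℝ) + 1) := by
      exact_mod_cast Nat.add_one_mul_choose_eq M K
    have hKM : (K : ℝ) ≤ M := by exact_mod_cast (by omega : K ≤ M)
    have h3 : (M.choose K : ℝ) = ((M + 2).choose (K + 2) : ℝ) *
        (((K : ℝ) + 2) / (M + 2)) * (((K : ℝ) + 1) / (M + 1)) := by
      have e1 : (M.choose K : ℝ) = ((M + 1).choose (K + 1) : ℝ) * (((K : ℝ) + 1) / (M + 1)) := by
        rw [← mul_div_assoc, ← h2]; field_simp
      have e2 : ((M + 1).choose (K + 1) : ℝ) =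
          ((M + 2).choose (K + 2) : ℝ) * (((K : ℝ) + 2) / (M + 2)) := by
        rw [← mul_div_assoc, ← h1]; field_simp
      rw [e1, e2]
    rw [h3, sq, ← mul_assoc]
    push_cast
    gcongr ?_ * ?_
    rw [div_le_div_iff₀ (by positivity) (by positivity)]
    nlinarith

theorem sum_powersetCard_sum {α : Type*} [DecidableEq α] {F : Finset α} {k : ℕ}
    (hk : 1 ≤ k) (hkF : k ≤ #F) (x : α → ℝ) :
    ∑ S ∈ F.powersetCard k, ∑ e ∈ S, x e = (#F).choose k * (k / #F) * ∑ e ∈ F, x e := by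
  have h1 : ∀ S ∈ F.powersetCard k, ∑ e ∈ S, x e = ∑ e ∈ F, if e ∈ S then x e else 0 := by
    intro S hS
    rw [sum_ite_mem, inter_eq_right.2 (mem_powersetCard.1 hS).1]
  rw [sum_congr rfl h1, sum_comm, mul_sum]
  refine sum_congr rfl fun e he => ?_
  rw [← sum_filter, sum_const, nsmul_eq_mul, card_filter_mem_powersetCard hk hkF he]

theorem sum_powersetCard_sum_sq_le {α : Type*} [DecidableEq α] {F : Finset α} {k : ℕ}
    (hk : 1 ≤ k) (hkF : k ≤ #F) {x : α → ℝ} (hx : ∀ e, 0 ≤ x e) :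
    ∑ S ∈ F.powersetCard k, (∑ e ∈ S, x e) ^ 2 ≤
      (#F).choose k * (k / #F * ∑ e ∈ F, x e ^ 2 + (k / #F) ^ 2 * (∑ e ∈ F, x e) ^ 2) := by
  have h1 : ∀ S ∈ F.powersetCard k, (∑ e ∈ S, x e) ^ 2 =
      ∑ e ∈ F, ∑ f ∈ F, if e ∈ S ∧ f ∈ S then x e * x f else 0 := by
    intro S hS
    have hs : ∑ e ∈ S, x e = ∑ e ∈ F, if e ∈ S then x e else 0 := by
      rw [sum_ite_mem, inter_eq_right.2 (mem_powersetCard.1 hS).1]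
    rw [hs, sq, sum_mul_sum]
    refine sum_congr rfl fun e _ => sum_congr rfl fun f _ => ?_
    by_cases he : e ∈ S <;> by_cases hf : f ∈ S <;> simp [he, hf]
  have h2 : (#F).choose k * (k / #F * ∑ e ∈ F, x e ^ 2 + (k / #F) ^ 2 * (∑ e ∈ F, x e) ^ 2) =
      ∑ e ∈ F, ∑ f ∈ F, (((#F).choose k * (k / #F) ^ 2) * (x e * x f) +
        if e = f then (#F).choose k * (k / #F) * (x e * x f) else 0) := by
    simp_rw [sum_add_distrib, sum_ite_eq, ← mul_sum]
    rw [sum_congr rfl fun e he => if_pos he, ← mul_sum, sq (∑ e ∈ F, x e), sum_mul]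
    simp_rw [sq (x _)]
    ring
  rw [sum_congr rfl h1, h2, sum_comm]
  refine sum_le_sum fun e he => ?_
  rw [sum_comm]
  refine sum_le_sum fun f hf => ?_
  rw [← sum_filter, sum_const, nsmul_eq_mul]
  have hxx : 0 ≤ x e * x f := mul_nonneg (hx e) (hx f)
  by_cases hef : e = f
  · subst hef
    simp only [and_self, if_true]
    rw [card_filter_mem_powersetCard hk hkF he]
    exact le_add_of_nonneg_left (by positivity)
  · rw [if_neg hef, add_zero]
    gcongr
    exact card_filter_mem_mem_powersetCard_le hkF he hf hef

/-- The expectation of `g` at a random subset of `E` retaining each element independently with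
probability `p`. -/
noncomputable def binomialExp {α : Type*} (E : Finset α) (p : ℝ) (g : Finset α → ℝ) : ℝ :=
  ∑ F ∈ E.powerset, p ^ #F * (1 - p) ^ (#E - #F) * g F

theorem binomialExp_mono {α : Type*} {E : Finset α} {p : ℝ} (hp0 : 0 ≤ p) (hp1 : p ≤ 1)
    {g h : Finset α → ℝ} (hgh : ∀ F ⊆ E, g F ≤ h F) : binomialExp E p g ≤ binomialExp E p h := by
  have : 0 ≤ 1 - p := by linarith
  refine sum_le_sum fun F hF => ?_
  gcongr
  exact hgh F (mem_powerset.1 hF)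

theorem binomialExp_add {α : Type*} (E : Finset α) (p : ℝ) (g h : Finset α → ℝ) :
    binomialExp E p (fun F => g F + h F) = binomialExp E p g + binomialExp E p h := by
  simp only [binomialExp, mul_add, sum_add_distrib]

theorem binomialExp_const {α : Type*} (E : Finset α) (p c : ℝ) :
    binomialExp E p (fun _ => c) = c := by
  rw [binomialExp, ← sum_mul, sum_pow_mul_eq_add_pow]
  simp

theorem binomialExp_eq_sum_powersetCard {α : Type*} (E : Finset α) (p : ℝ)
    (g : Finset α → ℝ) :
    binomialExp E p g =
      ∑ k ∈ range (#E + 1), p ^ k * (1 - p) ^ (#E - k) * ∑ F ∈ E.powersetCard k, g F := by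
  rw [binomialExp, sum_powerset]
  refine sum_congr rfl fun k _ => ?_
  rw [mul_sum]
  refine sum_congr rfl fun F hF => ?_
  rw [(mem_powersetCard.1 hF).2]

/-- Retaining elements with probability `p` and then with probability `r` amounts to retaining
them with probability `p * r`. -/
theorem binomialExp_binomialExp {α : Type*} [DecidableEq α] (E : Finset α) (p r : ℝ)
    (g : Finset α → ℝ) :
    binomialExp E p (fun F => binomialExp F r g) = binomialExp E (p * r) g := by
  simp only [binomialExp, mul_sum]
  rw [sum_comm' (t' := E.powerset) (s' := fun S => {F ∈ E.powerset | S ⊆ F})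
    (by intro F S; simp only [mem_powerset, mem_filter]
        exact ⟨fun h => ⟨⟨h.1, h.2⟩, h.2.trans h.1⟩, fun h => ⟨h.1.1, h.1.2⟩⟩)]
  refine sum_congr rfl fun S hS => ?_
  rw [mem_powerset] at hS
  have hcard : #(E \ S) = #E - #S := card_sdiff_of_subset hS
  have key := sum_pow_mul_eq_add_pow (p * (1 - r)) (1 - p) (E \ S)
  rw [hcard, show p * (1 - r) + (1 - p) = 1 - p * r by ring] at key
  rw [← key, mul_sum, sum_mul]
  refine sum_nbij' (fun F => F \ S) (fun T => T ∪ S) ?_ ?_ ?_ ?_ ?_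
  · intro F hF
    simp only [mem_filter, mem_powerset] at hF ⊢
    exact sdiff_subset_sdiff hF.1 le_rfl
  · intro T hT
    simp only [mem_filter, mem_powerset] at hT ⊢
    exact ⟨union_subset (hT.trans sdiff_subset) hS, subset_union_right⟩
  · intro F hF
    simp only [mem_filter, mem_powerset] at hF
    exact sdiff_union_of_subset hF.2
  · intro T hT
    simp only [mem_powerset] at hT
    rw [union_sdiff_right]
    exact sdiff_eq_self_of_disjoint (disjoint_of_subset_left hT sdiff_disjoint)
  · intro F hF
    simp only [mem_filter, mem_powerset] at hF
    have h1 : #(F \ S) = #F - #S := card_sdiff_of_subset hF.2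
    have h2 := card_le_card hF.1
    have h3 := card_le_card hF.2
    have h4 : p ^ #F = p ^ #S * p ^ (#F - #S) := by rw [← pow_add]; congr 1; omega
    have h5 : #E - #S - (#F - #S) = #E - #F := by omega
    rw [h1, h4, h5, mul_pow, mul_pow]
    ring

theorem binomialExp_inv_card_add_one_le {α : Type*} (E : Finset α) {p : ℝ} (hp0 : 0 < p)
    (hp1 : p ≤ 1) :
    binomialExp E p (fun F => 2 / (#F + 1)) ≤ 2 / ((#E + 1) * p) := by
  have hq : 0 ≤ 1 - p := by linarith
  rw [binomialExp_eq_sum_powersetCard, le_div_iff₀ (by positivity), sum_mul]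
  have hterm : ∀ k ∈ range (#E + 1),
      p ^ k * (1 - p) ^ (#E - k) * (∑ F ∈ E.powersetCard k, (2 / ((#F : ℝ) + 1))) *
        ((#E + 1) * p) =
      2 * (p ^ (k + 1) * (1 - p) ^ (#E + 1 - (k + 1)) * (#E + 1).choose (k + 1)) := by
    intro k _
    have hs : ∑ F ∈ E.powersetCard k, (2 / ((#F : ℝ) + 1)) =
        (#E).choose k * (2 / ((k : ℝ) + 1)) := by
      rw [← card_powersetCard, ← nsmul_eq_mul, ← sum_const]
      exact sum_congr rfl fun F hF => by rw [(mem_powersetCard.1 hF).2]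
    have hc : ((#E : ℝ) + 1) * ((#E).choose k : ℝ) =
        ((#E + 1).choose (k + 1) : ℝ) * ((k : ℝ) + 1) := by
      exact_mod_cast Nat.add_one_mul_choose_eq (#E) k
    have hc' : ((#E + 1).choose (k + 1) : ℝ) =
        ((#E : ℝ) + 1) * ((#E).choose k : ℝ) / ((k : ℝ) + 1) := by
      rw [hc]; field_simp
    rw [hs, Nat.add_sub_add_right, hc', pow_succ]
    ring
  rw [sum_congr rfl hterm, ← mul_sum]
  have hbin := add_pow p (1 - p) (#E + 1)
  rw [sum_range_succ'] at hbin
  have h0 : 0 ≤ p ^ 0 * (1 - p) ^ (#E + 1 - 0) * ((#E + 1).choose 0 : ℝ) := by positivity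
  have : (p + (1 - p)) ^ (#E + 1) = 1 := by simp
  linarith

/-- An abstract form of the modularity score of a set `S` of edges, where `a e` is the number of
parts containing the edge `e`, and `w i e` is the number of endpoints of `e` in the part `i`. -/
noncomputable def edgeScore {α ι : Type*} (T : Finset ι) (a : α → ℝ) (w : ι → α → ℝ)
    (S : Finset α) : ℝ :=
  (∑ e ∈ S, a e) / #S - (∑ i ∈ T, (∑ e ∈ S, w i e) ^ 2) / (4 * (#S : ℝ) ^ 2)

theorem edgeScore_le {α ι : Type*} (T : Finset ι) {a : α → ℝ} (w : ι → α → ℝ) {F : Finset α}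
    (ha : ∀ e ∈ F, a e ≤ 2) : edgeScore T a w F ≤ 2 := by
  have h1 : (∑ e ∈ F, a e) / #F ≤ 2 := by
    refine div_le_of_le_mul₀ (by positivity) (by norm_num) ?_
    calc ∑ e ∈ F, a e ≤ ∑ e ∈ F, (2 : ℝ) := sum_le_sum ha
      _ = 2 * #F := by simp [mul_comm]
  have h2 : 0 ≤ (∑ i ∈ T, (∑ e ∈ F, w i e) ^ 2) / (4 * (#F : ℝ) ^ 2) := by positivity
  rw [edgeScore]
  linarith

/-- The average score of the `k`-subsets of `F` is at most `2 / (k + 1)` below that of `F`. -/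
theorem edgeScore_le_sum_powersetCard {α ι : Type*} [DecidableEq α] (T : Finset ι) {a : α → ℝ}
    {w : ι → α → ℝ} {F : Finset α} (ha : ∀ e ∈ F, a e ≤ 2) (hw : ∀ i e, 0 ≤ w i e)
    (hw4 : ∀ e ∈ F, ∑ i ∈ T, w i e ^ 2 ≤ 4) {k : ℕ} (hkF : k ≤ #F) :
    (#F).choose k * edgeScore T a w F ≤
      ∑ S ∈ F.powersetCard k, (edgeScore T a w S + 2 / (#S + 1)) := by
  rcases Nat.eq_zero_or_pos k with rfl | hk
  · have := edgeScore_le T w ha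
    simpa [edgeScore] using this
  have hk0 : (0 : ℝ) < k := by exact_mod_cast hk
  have hm0 : (0 : ℝ) < #F := by exact_mod_cast hk.trans_le hkF
  have hC : (0 : ℝ) ≤ (#F).choose k := by positivity
  have hsum : ∑ S ∈ F.powersetCard k, (edgeScore T a w S + 2 / ((#S : ℝ) + 1)) =
      (∑ S ∈ F.powersetCard k, ∑ e ∈ S, a e) / k
        - (∑ i ∈ T, ∑ S ∈ F.powersetCard k, (∑ e ∈ S, w i e) ^ 2) / (4 * (k : ℝ) ^ 2)
        + (#F).choose k * (2 / ((k : ℝ) + 1)) := by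
    rw [sum_add_distrib]
    congr 1
    · rw [sum_comm, sum_div, sum_div, ← sum_sub_distrib]
      refine sum_congr rfl fun S hS => ?_
      rw [edgeScore, (mem_powersetCard.1 hS).2]
    · rw [← card_powersetCard, ← nsmul_eq_mul, ← sum_const]
      exact sum_congr rfl fun S hS => by rw [(mem_powersetCard.1 hS).2]
  have hB : ∑ i ∈ T, ∑ S ∈ F.powersetCard k, (∑ e ∈ S, w i e) ^ 2 ≤
      (#F).choose k * (4 * k + (k / #F) ^ 2 * ∑ i ∈ T, (∑ e ∈ F, w i e) ^ 2) := by
    calc _ ≤ ∑ i ∈ T, ((#F).choose k * (k / #F * ∑ e ∈ F, w i e ^ 2 +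
          (k / #F) ^ 2 * (∑ e ∈ F, w i e) ^ 2) : ℝ) :=
        sum_le_sum fun i _ => sum_powersetCard_sum_sq_le hk hkF (hw i)
      _ = (#F).choose k * (k / #F * (∑ e ∈ F, ∑ i ∈ T, w i e ^ 2) +
          (k / #F) ^ 2 * ∑ i ∈ T, (∑ e ∈ F, w i e) ^ 2) := by
        rw [← mul_sum, sum_add_distrib, ← mul_sum, ← mul_sum, sum_comm]
      _ ≤ _ := by
        gcongr ?_ * (?_ + _)
        calc (k : ℝ) / #F * (∑ e ∈ F, ∑ i ∈ T, w i e ^ 2) ≤ k / #F * (∑ e ∈ F, 4) := by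
              gcongr with e he; exact hw4 e he
          _ = 4 * k := by rw [sum_const, nsmul_eq_mul]; field_simp
  rw [hsum, sum_powersetCard_sum hk hkF, edgeScore]
  have hB' : (∑ i ∈ T, ∑ S ∈ F.powersetCard k, (∑ e ∈ S, w i e) ^ 2) / (4 * (k : ℝ) ^ 2) ≤
      (#F).choose k * (1 / k + (∑ i ∈ T, (∑ e ∈ F, w i e) ^ 2) / (4 * (#F : ℝ) ^ 2)) := by
    rw [div_le_iff₀ (by positivity)]
    refine hB.trans (le_of_eq ?_)
    field_simp
  have hinv : (1 : ℝ) / k ≤ 2 / (k + 1) := by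
    rw [div_le_div_iff₀ hk0 (by positivity)]
    have : (1 : ℝ) ≤ k := by exact_mod_cast hk
    linarith
  have hA : (#F).choose k * (k / #F) * (∑ e ∈ F, a e) / k =
      (#F).choose k * ((∑ e ∈ F, a e) / #F) := by field_simp
  have := mul_le_mul_of_nonneg_left hinv hC
  rw [hA]
  linarith

theorem edgeScore_le_binomialExp {α ι : Type*} [DecidableEq α] (T : Finset ι) {a : α → ℝ}
    {w : ι → α → ℝ} {F : Finset α} (ha : ∀ e ∈ F, a e ≤ 2) (hw : ∀ i e, 0 ≤ w i e)
    (hw4 : ∀ e ∈ F, ∑ i ∈ T, w i e ^ 2 ≤ 4) {r : ℝ} (hr0 : 0 ≤ r) (hr1 : r ≤ 1) :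
    edgeScore T a w F ≤ binomialExp F r (fun S => edgeScore T a w S + 2 / (#S + 1)) := by
  have hq : 0 ≤ 1 - r := by linarith
  rw [← binomialExp_const F r (edgeScore T a w F), binomialExp_eq_sum_powersetCard,
    binomialExp_eq_sum_powersetCard]
  refine sum_le_sum fun k hk => mul_le_mul_of_nonneg_left ?_ (by positivity)
  rw [sum_const, card_powersetCard, nsmul_eq_mul]
  exact edgeScore_le_sum_powersetCard T ha hw hw4 (Nat.lt_succ_iff.1 (mem_range.1 hk))

theorem edgeFinset_fromEdgeSet_coe {V : Type} [Fintype V] [DecidableEq V] {F : Finset (Sym2 V)}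
    (hF : F ⊆ (⊤ : SimpleGraph V).edgeFinset)
    {_ : Fintype (SimpleGraph.fromEdgeSet (F : Set (Sym2 V))).edgeSet} :
    (SimpleGraph.fromEdgeSet (F : Set (Sym2 V))).edgeFinset = F := by
  ext e
  rw [SimpleGraph.mem_edgeFinset, SimpleGraph.edgeSet_fromEdgeSet]
  simp only [Set.mem_sdiff, mem_coe, and_iff_left_iff_imp]
  intro he
  have := hF he
  rw [SimpleGraph.mem_edgeFinset] at this
  simpa using this

/-- The modularity score of the graph with edge set `F` is the score of `F`. -/
theorem modScore_fromEdgeSet {V : Type} [Fintype V] [DecidableEq V] {F : Finset (Sym2 V)}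
    (hF : F ⊆ (⊤ : SimpleGraph V).edgeFinset) (P : Finpartition (univ : Finset V)) :
    modScore (SimpleGraph.fromEdgeSet (F : Set (Sym2 V))) P =
      edgeScore P.parts (fun e => (#{A ∈ P.parts | ∀ v ∈ e, v ∈ A} : ℝ))
        (fun A e => (#{v ∈ A | v ∈ e} : ℝ)) F := by
  have hcount : edgeCount (SimpleGraph.fromEdgeSet (F : Set (Sym2 V))) = #F := by
    rw [edgeCount, edgeFinset_fromEdgeSet_coe hF]
  have hint : ∑ A ∈ P.parts, (intEdges (SimpleGraph.fromEdgeSet (F : Set (Sym2 V))) A : ℝ) =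
      ∑ e ∈ F, (#{A ∈ P.parts | ∀ v ∈ e, v ∈ A} : ℝ) := by
    simp only [intEdges, edgeFinset_fromEdgeSet_coe hF]
    exact_mod_cast (sum_card_bipartiteAbove_eq_sum_card_bipartiteBelow
      (s := P.parts) (t := F) (fun (A : Finset V) (e : Sym2 V) => ∀ v ∈ e, v ∈ A))
  have hdeg : ∀ A : Finset V, (degSum (SimpleGraph.fromEdgeSet (F : Set (Sym2 V))) A : ℝ) =
      ∑ e ∈ F, (#{v ∈ A | v ∈ e} : ℝ) := by
    intro A
    simp only [degSum, ← SimpleGraph.card_incidenceFinset_eq_degree,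
      SimpleGraph.incidenceFinset_eq_filter, edgeFinset_fromEdgeSet_coe hF]
    exact_mod_cast (sum_card_bipartiteAbove_eq_sum_card_bipartiteBelow
      (s := A) (t := F) (fun (v : V) (e : Sym2 V) => v ∈ e))
  rw [modScore, edgeScore, hcount, hint]
  simp only [hdeg]
  split_ifs with h
  · simp [h]
  · rfl

/-- The endpoints of an edge are distributed among the parts of a partition. -/
theorem sum_card_filter_mem_le_two {V : Type} [Fintype V] [DecidableEq V]
    (P : Finpartition (univ : Finset V)) (e : Sym2 V) :
    ∑ A ∈ P.parts, (#{v ∈ A | v ∈ e} : ℝ) ≤ 2 := by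
  have h1 : ∑ A ∈ P.parts, #{v ∈ A | v ∈ e} = #{v ∈ (univ : Finset V) | v ∈ e} := by
    conv_rhs => rw [← P.biUnion_parts, filter_biUnion]
    rw [card_biUnion]
    · rfl
    · intro A hA B hB hAB
      exact disjoint_filter_filter (P.disjoint hA hB hAB)
  have h2 : #{v ∈ (univ : Finset V) | v ∈ e} ≤ 2 := by
    induction e with
    | _ x y =>
      calc #{v ∈ (univ : Finset V) | v ∈ s(x, y)} ≤ #({x, y} : Finset V) :=
            card_le_card fun v hv => by simpa using hv
        _ ≤ 2 := card_le_two
  exact_mod_cast h1.trans_le h2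

/-- Sampling the edges of a graph lowers its modularity on average by at most the expectation of
`2 / (k + 1)`, where `k` is the number of sampled edges. -/
theorem modularity_le_binomialExp {V : Type} [Fintype V] [DecidableEq V] {F : Finset (Sym2 V)}
    (hF : F ⊆ (⊤ : SimpleGraph V).edgeFinset) {r : ℝ} (hr0 : 0 ≤ r) (hr1 : r ≤ 1) :
    modularity (SimpleGraph.fromEdgeSet (F : Set (Sym2 V))) ≤
      binomialExp F r (fun S =>
        modularity (SimpleGraph.fromEdgeSet (S : Set (Sym2 V))) + 2 / (#S + 1)) := by
  refine ciSup_le fun P => ?_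
  rw [modScore_fromEdgeSet hF]
  refine (edgeScore_le_binomialExp P.parts ?_ (fun _ _ => by positivity) ?_ hr0 hr1).trans
    (binomialExp_mono hr0 hr1 fun S hS => ?_)
  · intro e _
    refine le_trans ?_ (sum_card_filter_mem_le_two P e)
    rw [card_filter]
    push_cast
    refine sum_le_sum fun A _ => ?_
    split_ifs with h
    · have hpos : 0 < #{v ∈ A | v ∈ e} :=
        card_pos.2 ⟨e.out.1, by simp [h _ e.out_fst_mem, e.out_fst_mem]⟩
      exact_mod_cast hpos
    · positivity
  · intro e _
    calc ∑ A ∈ P.parts, (#{v ∈ A | v ∈ e} : ℝ) ^ 2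
        ≤ (∑ A ∈ P.parts, (#{v ∈ A | v ∈ e} : ℝ)) ^ 2 :=
          sum_sq_le_sq_sum_of_nonneg fun A _ => by positivity
      _ ≤ 2 ^ 2 := by gcongr; exact sum_card_filter_mem_le_two P e
      _ = 4 := by norm_num
  · rw [← modScore_fromEdgeSet (hS.trans hF)]
    gcongr
    exact le_ciSup (f := fun P => modScore (SimpleGraph.fromEdgeSet (S : Set (Sym2 V))) P)
      (Set.finite_range _).bddAbove P

theorem expModER_sub_le {n : ℕ} {c c' : ℝ} (hc : 0 < c) (hcc' : c < c') (hn : 2 ≤ n)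
    (hn' : c' ≤ n) : expModER n (c' / n) - expModER n (c / n) ≤ 4 / (c * (n - 1)) := by
  have hn0 : (0 : ℝ) < n := by exact_mod_cast (by omega : 0 < n)
  have hn1 : (0 : ℝ) < (n : ℝ) - 1 := by
    have : (2 : ℝ) ≤ n := by exact_mod_cast hn
    linarith
  have hc' : 0 < c' := hc.trans hcc'
  set E := (⊤ : SimpleGraph (Fin n)).edgeFinset with hE
  set g : Finset (Sym2 (Fin n)) → ℝ :=
    fun F => modularity (SimpleGraph.fromEdgeSet (F : Set (Sym2 (Fin n)))) with hg
  have hexp : ∀ p, expModER n p = binomialExp E p g := fun p => rfl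
  have h1 : binomialExp E (c' / n) g ≤
      binomialExp E (c' / n) (fun F => binomialExp F (c / c') fun S => g S + 2 / (#S + 1)) :=
    binomialExp_mono (by positivity) ((div_le_one hn0).2 hn') fun F hF =>
      modularity_le_binomialExp hF (by positivity) ((div_le_one hc').2 hcc'.le)
  rw [binomialExp_binomialExp, show c' / (n : ℝ) * (c / c') = c / n by field_simp,
    binomialExp_add] at h1
  have h2 := binomialExp_inv_card_add_one_le E (p := c / n) (by positivity)
    ((div_le_one hn0).2 (hcc'.le.trans hn'))
  have hcard : (#E : ℝ) = n * (n - 1) / 2 := by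
    rw [hE, SimpleGraph.card_edgeFinset_top_eq_card_choose_two, Fintype.card_fin,
      Nat.cast_choose_two]
  have h3 : 2 / (((#E : ℝ) + 1) * (c / n)) ≤ 4 / (c * (n - 1)) := by
    rw [hcard, div_le_div_iff₀ (by positivity) (by positivity)]
    have : (n * ((n : ℝ) - 1) / 2 + 1) * (c / n) = c * (n - 1) / 2 + c / n := by field_simp
    rw [this]
    have : 0 < c / n := by positivity
    linarith
  rw [hexp, hexp]
  linarith

/-- No lower bound on `u` is needed, since a set of reals that is unbounded below has infimum `0`.
-/
theorem limsup_le_zero_of_eventually_le {u : ℕ → ℝ}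
    (hu : ∀ ε : ℝ, 0 < ε → ∀ᶠ n in Filter.atTop, u n ≤ ε) :
    Filter.limsup u Filter.atTop ≤ 0 := by
  rw [Filter.limsup_eq]
  by_cases hb : BddBelow {a | ∀ᶠ n in Filter.atTop, u n ≤ a}
  · refine le_of_forall_pos_le_add fun ε hε => ?_
    rw [zero_add]
    exact csInf_le hb (hu ε hε)
  · rw [Real.sInf_of_not_bddBelow hb]

/-- Monotonicity on average: for 0 < c < c′, for every ε > 0 there is n₀ such that
for all n ≥ n₀ (with n large enough that c′/n ≤ 1),
E[q*(G_{n, c′/n})] − E[q*(G_{n, c/n})] < ε; consequently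
limsup_{n→∞} (E[q*(G_{n, c′/n})] − E[q*(G_{n, c/n})]) ≤ 0. -/
theorem statement17 (c c' : ℝ) (hc : 0 < c) (hcc' : c < c') :
    (∀ ε : ℝ, 0 < ε →
      ∃ n₀ : ℕ, ∀ n : ℕ, n₀ ≤ n → c' ≤ (n : ℝ) →
        expModER n (c' / n) - expModER n (c / n) < ε) ∧
    Filter.limsup (fun n : ℕ => expModER n (c' / n) - expModER n (c / n))
      Filter.atTop ≤ 0 := by
  have main : ∀ ε : ℝ, 0 < ε → ∃ n₀ : ℕ, ∀ n : ℕ, n₀ ≤ n → c' ≤ (n : ℝ) →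
      expModER n (c' / n) - expModER n (c / n) < ε := by
    intro ε hε
    obtain ⟨N, hN⟩ := exists_nat_gt (4 / (c * ε) + 1)
    refine ⟨max N 2, fun n hn hn' => ?_⟩
    refine (expModER_sub_le hc hcc' (le_of_max_le_right hn) hn').trans_lt ?_
    have hNn : (N : ℝ) ≤ n := by exact_mod_cast le_of_max_le_left hn
    have h1 : 4 / (c * ε) < (n : ℝ) - 1 := by linarith
    have h0 : 0 < (n : ℝ) - 1 := lt_trans (by positivity) h1
    rw [div_lt_iff₀ (by positivity)] at h1 ⊢
    linarith
  refine ⟨main, limsup_le_zero_of_eventually_le fun ε hε => ?_⟩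
  obtain ⟨n₀, h⟩ := main ε hε
  filter_upwards [Filter.eventually_ge_atTop n₀,
    tendsto_natCast_atTop_atTop.eventually_ge_atTop c'] with n hn hn'
  exact (h n hn hn').le
end
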